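/- If a deformation space D consists of locally finite G-trees with finitely generated vertex stabilizers, then the equivariant Gromov-Hausdorff topology and the weak topology coincide on D and on the projectivized space PD. -/

import Mathlib

set_option autoImplicit false
set_option maxHeartbeats 1000000
open scoped Classical

universe u

section Trees

variable (G : Type u) [Group G]

/-- A (minimal, simplicial) `G`-tree: a simplicial tree together with an action of `G` by
simplicial automorphisms, without inversions, admitting no proper invariant subtree. -/
structure GTree : Type (u + 1) where
  V : Type u
  nonempty : Nonempty V
  graph : SimpleGraph V
  isTree : graph.IsTree
  act : G →* Equiv.Perm V
  adj_act : ∀ (g : G) (u v : V), graph.Adj u v → graph.Adj (act g u) (act g v)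
  noInversion : ∀ (g : G) (u v : V), graph.Adj u v → ¬(act g u = v ∧ act g v = u)
  minimal : ∀ S : Set V, S.Nonempty → (∀ (g : G), ∀ v ∈ S, act g v ∈ S) →
      (∀ u ∈ S, ∀ v ∈ S, ∀ p : graph.Walk u v, p.IsPath → ∀ w ∈ p.support, w ∈ S) →
      S = Set.univ

variable {G}

namespace GTree

variable (T : GTree G)

/-- The stabilizer of a vertex. -/
def stab (v : T.V) : Subgroup G where
  carrier := {g : G | T.act g v = v}
  one_mem' := by simp
  mul_mem' := by
    intro a b ha hb
    simp only [Set.mem_setOf_eq, map_mul, Equiv.Perm.mul_apply] at *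
    rw [hb, ha]
  inv_mem' := by
    intro a ha
    simp only [Set.mem_setOf_eq] at *
    have h : T.act a⁻¹ (T.act a v) = v := by
      rw [← Equiv.Perm.mul_apply, ← map_mul, inv_mul_cancel, map_one, Equiv.Perm.one_apply]
    rwa [ha] at h

/-- The (pointwise) stabilizer of an edge `uv`; since the action has no inversions this is
the full stabilizer of the edge. -/
def edgeStab (u v : T.V) : Subgroup G := T.stab u ⊓ T.stab v

/-- A subgroup of `G` is elliptic if it fixes a vertex. -/
def Elliptic (H : Subgroup G) : Prop := ∃ v : T.V, ∀ h ∈ H, T.act h v = v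

/-- An element of `G` is elliptic if it fixes a vertex. -/
def EllipticElt (g : G) : Prop := ∃ v : T.V, T.act g v = v

/-- An element of `G` is hyperbolic if it fixes no vertex. -/
def Hyperbolic (g : G) : Prop := ∀ v : T.V, T.act g v ≠ v

/-- A `G`-tree is reduced if whenever the stabilizer of an edge `uv` equals the stabilizer
of `u` (i.e. `G_u ≤ G_v`), the two endpoints are in the same orbit. -/
def Reduced : Prop :=
  ∀ u v : T.V, T.graph.Adj u v → T.stab u ≤ T.stab v → ∃ g : G, T.act g u = v

/-- `T` is a single point. -/
protected def Trivial : Prop := ∀ u v : T.V, u = v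

/-- `T` is a (simplicial) line. -/
def IsLine : Prop := ∀ v : T.V, ∃ a b : T.V, a ≠ b ∧ {w : T.V | T.graph.Adj v w} = {a, b}

/-- `G` fixes an end of `T`: there is an equivariant choice, for each vertex, of the next
vertex in the direction of the fixed end. -/
def FixesEnd : Prop :=
  ∃ next : T.V → T.V, (∀ v, T.graph.Adj v (next v)) ∧
    (∀ (g : G) (v : T.V), next (T.act g v) = T.act g (next v)) ∧
    (∀ v, next (next v) ≠ v)

/-- Linear abelian type: `T` is a line on which `G` acts by translations (every element acts
either trivially or freely). -/
def LinearAbelian : Prop :=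
  T.IsLine ∧ ∀ g : G, (∀ v : T.V, T.act g v = v) ∨ (∀ v : T.V, T.act g v ≠ v)

/-- Dihedral type: `T` is a line and some element acts as a reflection. -/
def Dihedral : Prop :=
  T.IsLine ∧ ∃ g : G, (∃ v : T.V, T.act g v = v) ∧ (∃ w : T.V, T.act g w ≠ w)

/-- Genuine abelian type: `G` fixes an end and `T` is not a line. -/
def GenuineAbelian : Prop := T.FixesEnd ∧ ¬T.IsLine

/-- Irreducibility, via the characterization by hyperbolicity of a commutator. -/
def Irred : Prop :=
  ∃ g h : G, T.Hyperbolic g ∧ T.Hyperbolic h ∧ T.Hyperbolic (g * h * g⁻¹ * h⁻¹)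

/-- The image of a dart (oriented edge) under the action of `g`. -/
def dartAct (g : G) (d : T.graph.Dart) : T.graph.Dart :=
  ⟨(T.act g d.toProd.1, T.act g d.toProd.2), T.adj_act g d.toProd.1 d.toProd.2 d.adj⟩

/-- Three oriented edges are aligned (in this order) if some geodesic crosses them
successively, with the correct orientations. -/
def Aligned (d₁ d₂ d₃ : T.graph.Dart) : Prop :=
  ∃ (u v : T.V) (p : T.graph.Walk u v), p.IsPath ∧ [d₁, d₂, d₃].Sublist p.darts

end GTree

/-- Two `G`-trees lie in the same deformation space iff they have the same elliptic
subgroups. -/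
def SameDef (T T' : GTree G) : Prop := ∀ H : Subgroup G, T.Elliptic H ↔ T'.Elliptic H

/-- An equivariant isomorphism of simplicial `G`-trees. -/
def SimpIso (T T' : GTree G) : Prop :=
  ∃ e : T.V ≃ T'.V, (∀ (g : G) (v : T.V), e (T.act g v) = T'.act g (e v)) ∧
    ∀ u v : T.V, T.graph.Adj u v ↔ T'.graph.Adj (e u) (e v)

end Trees
section Collapses

variable {G : Type u} [Group G]

/-- Two ordered pairs of adjacent vertices span edges in the same `G`-orbit
(as non-oriented edges). -/
def InEdgeOrbit (T : GTree G) (a b c d : T.V) : Prop :=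
  ∃ g : G, (T.act g a = c ∧ T.act g b = d) ∨ (T.act g a = d ∧ T.act g b = c)

/-- `c` exhibits `T'` as a (possibly non-elementary) collapse of `T`: it is equivariant,
surjective, sends non-collapsed edges to edges, is onto the edges of `T'`, and its point
preimages are subtrees. -/
def IsCollapseMap (T T' : GTree G) (c : T.V → T'.V) : Prop :=
  (∀ (g : G) (v : T.V), c (T.act g v) = T'.act g (c v)) ∧
  Function.Surjective c ∧
  (∀ u v : T.V, T.graph.Adj u v → c u ≠ c v → T'.graph.Adj (c u) (c v)) ∧
  (∀ u' v' : T'.V, T'.graph.Adj u' v' → ∃ u v : T.V, T.graph.Adj u v ∧ c u = u' ∧ c v = v') ∧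
  (∀ u v : T.V, c u = c v → ∀ p : T.graph.Walk u v, p.IsPath → ∀ w ∈ p.support, c w = c u)

/-- `T'` is obtained from `T` by a (possibly non-elementary) collapse. -/
def CollapseOf (T' T : GTree G) : Prop := ∃ c : T.V → T'.V, IsCollapseMap T T' c

/-- `T'` is obtained from `T` by collapsing (exactly) all the edges in the orbit of a
single edge. -/
def IsOrbitCollapse (T' T : GTree G) : Prop :=
  ∃ (c : T.V → T'.V) (u₀ v₀ : T.V), T.graph.Adj u₀ v₀ ∧ IsCollapseMap T T' c ∧
    ∀ u v : T.V, T.graph.Adj u v → (c u = c v ↔ InEdgeOrbit T u v u₀ v₀)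

/-- An elementary collapse: collapsing the orbit of a collapsible edge, i.e. an orbit
collapse staying in the same deformation space. -/
def ElemCollapse (T T' : GTree G) : Prop := IsOrbitCollapse T' T ∧ SameDef T T'

/-- An elementary move: an elementary collapse or an elementary expansion. -/
def ElemMove (T T' : GTree G) : Prop := ElemCollapse T T' ∨ ElemCollapse T' T

/-- An elementary deformation: a finite sequence of elementary collapses and expansions. -/
def ElemDeformation (T T' : GTree G) : Prop := Relation.ReflTransGen ElemMove T T'

/-- A slide move: an edge `f = vx` with `G_f ≤ G_e` slides across `e = vw` (and
equivariantly so does its orbit), becoming an edge `f' = wx`. -/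
def SlideMove (T T' : GTree G) : Prop :=
  ∃ (e : T.V ≃ T'.V) (v w x : T.V),
    T.graph.Adj v w ∧ T.graph.Adj v x ∧ w ≠ x ∧
    T.edgeStab v x ≤ T.edgeStab v w ∧
    ¬InEdgeOrbit T v w v x ∧
    (∀ (g : G) (u : T.V), e (T.act g u) = T'.act g (e u)) ∧
    (∀ a b : T.V, T'.graph.Adj (e a) (e b) ↔
      ((T.graph.Adj a b ∧ ¬InEdgeOrbit T a b v x) ∨ InEdgeOrbit T a b w x))

end Collapses

section MetricTrees

variable (G : Type u) [Group G]

/-- A metric `G`-tree: a simplicial `G`-tree together with an equivariant assignment of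
positive lengths to the edges. -/
structure MGTree extends GTree G : Type (u + 1) where
  len : V → V → ℝ
  len_symm : ∀ u v : V, len u v = len v u
  len_pos : ∀ u v : V, graph.Adj u v → 0 < len u v
  len_equivariant : ∀ (g : G) (u v : V), len (act g u) (act g v) = len u v

variable {G}

namespace MGTree

variable (T : MGTree G)

/-- The length of a walk. -/
noncomputable def walkLen {u v : T.V} (p : T.graph.Walk u v) : ℝ :=
  (p.darts.map fun d => T.len d.toProd.1 d.toProd.2).sum

/-- The distance between two vertices: the length of the unique reduced path joining them. -/
noncomputable def dist (u v : T.V) : ℝ :=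
  sInf {x : ℝ | ∃ p : T.graph.Walk u v, p.IsPath ∧ x = T.walkLen p}

/-- The translation length of `g`. -/
noncomputable def ell (g : G) : ℝ :=
  sInf {x : ℝ | ∃ v : T.V, x = T.dist v (T.act g v)}

/-- The axis (or characteristic set) of `g`: the set of points moved exactly `ℓ(g)`. -/
def Axis (g : G) : Set T.V := {v : T.V | T.dist v (T.act g v) = T.ell g}

/-- `T` is abelian: its length function is the absolute value of a homomorphism to `ℝ`
with cyclic image. -/
def IsAbelian : Prop :=
  ∃ φ : G → ℝ, (∀ g h : G, φ (g * h) = φ g + φ h) ∧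
    (∃ a : ℝ, ∀ g : G, ∃ n : ℤ, φ g = (n : ℝ) * a) ∧
    ∀ g : G, T.ell g = |φ g|

/-- Irreducibility for metric trees: two hyperbolic elements with disjoint axes. -/
def Irr : Prop :=
  ∃ g h : G, T.toGTree.Hyperbolic g ∧ T.toGTree.Hyperbolic h ∧ T.Axis g ∩ T.Axis h = ∅

end MGTree

/-- An equivariant simplicial isomorphism multiplying all edge lengths by `c`. -/
def EquivHomothety (c : ℝ) (T T' : MGTree G) : Prop :=
  ∃ e : T.V ≃ T'.V, (∀ (g : G) (v : T.V), e (T.act g v) = T'.act g (e v)) ∧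
    (∀ u v : T.V, T.graph.Adj u v ↔ T'.graph.Adj (e u) (e v)) ∧
    ∀ u v : T.V, T.graph.Adj u v → T'.len (e u) (e v) = c * T.len u v

/-- An equivariant isometry of metric `G`-trees. -/
def EquivIsometric (T T' : MGTree G) : Prop := EquivHomothety 1 T T'

/-- The action of an automorphism of `G` on metric `G`-trees, by precomposition. -/
def MGTree.precomp (φ : MulAut G) (T : MGTree G) : MGTree G where
  V := T.V
  nonempty := T.nonempty
  graph := T.graph
  isTree := T.isTree
  act := T.act.comp φ.toMonoidHom
  adj_act := fun g u v h => T.adj_act (φ g) u v h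
  noInversion := fun g u v h => T.noInversion (φ g) u v h
  minimal := fun S h1 h2 h3 => T.minimal S h1
    (fun g v hv => by simpa using h2 (φ.symm g) v hv) h3
  len := T.len
  len_symm := T.len_symm
  len_pos := T.len_pos
  len_equivariant := fun g u v => T.len_equivariant (φ g) u v

end MetricTrees
section Topologies

variable (G : Type u) [Group G]

/-- Basic Gromov–Hausdorff neighbourhood of the metric `G`-tree `T` determined by finite
sets `X ⊆ T`, `A ⊆ G` and `ε > 0`: the trees admitting an `ε`-approximate equivariant
lift of `X`. -/
def gromovBasic (T : MGTree G) (X : Finset T.V) (A : Finset G) (ε : ℝ) : Set (MGTree G) :=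
  {T' : MGTree G | ∃ f : T.V → T'.V, ∀ x ∈ X, ∀ y ∈ X, ∀ g ∈ A,
    |T.dist x (T.act g y) - T'.dist (f x) (T'.act g (f y))| < ε}

/-- The equivariant Gromov–Hausdorff topology on the space of metric `G`-trees. -/
noncomputable def gromovTop : TopologicalSpace (MGTree G) where
  IsOpen U := ∀ T ∈ U, ∃ (X : Finset T.V) (A : Finset G) (ε : ℝ), 0 < ε ∧
    gromovBasic G T X A ε ⊆ U
  isOpen_univ := fun T _ => ⟨∅, ∅, 1, one_pos, Set.subset_univ _⟩
  isOpen_inter := by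
    intro U V hU hV T hT
    obtain ⟨X₁, A₁, ε₁, hε₁, h₁⟩ := hU T hT.1
    obtain ⟨X₂, A₂, ε₂, hε₂, h₂⟩ := hV T hT.2
    refine ⟨X₁ ∪ X₂, A₁ ∪ A₂, min ε₁ ε₂, lt_min hε₁ hε₂, ?_⟩
    intro T' hT'
    obtain ⟨f, hf⟩ := hT'
    constructor
    · exact h₁ ⟨f, fun x hx y hy g hg =>
        lt_of_lt_of_le (hf x (Finset.mem_union_left _ hx) y (Finset.mem_union_left _ hy) g
          (Finset.mem_union_left _ hg)) (min_le_left _ _)⟩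
    · exact h₂ ⟨f, fun x hx y hy g hg =>
        lt_of_lt_of_le (hf x (Finset.mem_union_right _ hx) y (Finset.mem_union_right _ hy) g
          (Finset.mem_union_right _ hg)) (min_le_right _ _)⟩
  isOpen_sUnion := by
    intro s hs T hT
    obtain ⟨U, hUs, hTU⟩ := hT
    obtain ⟨X, A, ε, hε, h⟩ := hs U hUs T hTU
    exact ⟨X, A, ε, hε, h.trans (Set.subset_sUnion_of_mem hUs)⟩

variable {G}

/-- The closed cone of the (restricted) deformation space `D` spanned by `T`: the trees
of `D` obtained from trees having the same underlying simplicial tree as `T` by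
(elementary) collapses. -/
def closedCone (D : Set (MGTree G)) (T : MGTree G) : Set (MGTree G) :=
  {T' : MGTree G | T' ∈ D ∧ CollapseOf T'.toGTree T.toGTree}

/-- The open cone containing `T`: the trees with the same underlying simplicial tree. -/
def openCone (D : Set (MGTree G)) (T : MGTree G) : Set (MGTree G) :=
  {T' : MGTree G | T' ∈ D ∧ SimpIso T'.toGTree T.toGTree}

variable (G)

/-- The weak topology on a deformation space `D`: a set is closed if and only if its
intersection with every closed cone of `D` is closed (each closed cone carrying the
Gromov topology). -/
noncomputable def weakTop (D : Set (MGTree G)) : TopologicalSpace ↥D :=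
  ⨆ (T : MGTree G) (_ : T ∈ D), TopologicalSpace.coinduced
    (fun x : {S : MGTree G // S ∈ closedCone D T} => (⟨x.1, x.2.1⟩ : ↥D))
    (TopologicalSpace.induced (fun x : {S : MGTree G // S ∈ closedCone D T} => x.1)
      (gromovTop G))

variable {G}

/-- The projectivizing relation on a deformation space: agreement up to rescaling, i.e.
equivariant homothety. -/
def projRel (D : Set (MGTree G)) (a b : ↥D) : Prop :=
  ∃ c : ℝ, 0 < c ∧ EquivHomothety c a.1 b.1

/-- The relation of equivariant isometry on a deformation space. -/
def isomRel (D : Set (MGTree G)) (a b : ↥D) : Prop := EquivIsometric a.1 b.1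

end Topologies

section Morphisms

variable {G : Type u} [Group G]

/-- A morphism of simplicial `G`-trees: an equivariant map sending each edge onto a
non-degenerate edge path (obtained by subdividing the edge into finitely many subsegments,
each mapped bijectively onto an edge). -/
structure GMorphism (T T' : GTree G) where
  f : T.V → T'.V
  equivariant : ∀ (g : G) (v : T.V), f (T.act g v) = T'.act g (f v)
  edgeWalk : ∀ u v : T.V, T.graph.Adj u v → T'.graph.Walk (f u) (f v)
  edgeWalk_ne_nil : ∀ (u v : T.V) (h : T.graph.Adj u v), ¬(edgeWalk u v h).Nil
  edgeWalk_symm : ∀ (u v : T.V) (h : T.graph.Adj u v),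
    (edgeWalk v u h.symm).support = (edgeWalk u v h).support.reverse
  edgeWalk_equivariant : ∀ (g : G) (u v : T.V) (h : T.graph.Adj u v),
    (edgeWalk (T.act g u) (T.act g v) (T.adj_act g u v h)).support =
      (edgeWalk u v h).support.map (fun x => T'.act g x)

/-- `H` is bi-elliptic in `T`: it fixes two distinct points. -/
def BiElliptic (T : GTree G) (H : Subgroup G) : Prop :=
  ∃ u v : T.V, u ≠ v ∧ ∀ h ∈ H, T.act h u = u ∧ T.act h v = v

/-- `H` is a generalized edge group of `T`: it is squeezed between two edge stabilizers. -/
def GenEdgeGroup (T : GTree G) (H : Subgroup G) : Prop :=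
  ∃ u v u' v' : T.V, T.graph.Adj u v ∧ T.graph.Adj u' v' ∧
    T.edgeStab u v ≤ H ∧ H ≤ T.edgeStab u' v'

/-- `H` belongs to `𝒜_min` (relative to the deformation space of `T₀`): it fixes an edge
in every tree of the deformation space. -/
def Amin (T₀ : GTree G) (H : Subgroup G) : Prop :=
  ∀ T : GTree G, SameDef T₀ T → ∃ u v : T.V, T.graph.Adj u v ∧ H ≤ T.edgeStab u v

/-- A maximal elliptic subgroup (of the deformation space of `T₀`). -/
def MaxElliptic (T₀ : GTree G) (H : Subgroup G) : Prop :=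
  T₀.Elliptic H ∧ ∀ K : Subgroup G, T₀.Elliptic K → H ≤ K → K = H

end Morphisms

section OutG

variable (G : Type u) [Group G]

instance innRange_normal : ((MulAut.conj : G →* MulAut G).range).Normal := by
  constructor
  intro a ha φ
  obtain ⟨g, rfl⟩ := ha
  refine ⟨φ g, ?_⟩
  ext x
  simp only [MulAut.mul_apply, MulAut.conj_apply, map_mul, map_inv]
  simp [MulAut.inv_def]

/-- The outer automorphism group of `G`. -/
def OutG := MulAut G ⧸ (MulAut.conj : G →* MulAut G).range

noncomputable instance : Group (OutG G) := QuotientGroup.Quotient.group _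

/-- The class of an automorphism in `Out(G)`. -/
def toOutG (φ : MulAut G) : OutG G := QuotientGroup.mk φ

end OutG
section RealTrees

variable (G : Type u) [Group G]

/-- A non-trivial minimal `ℝ`-tree with an isometric action of `G`: a geodesic metric
space in which any two points are joined by a unique arc. -/
structure RGTree : Type (u + 1) where
  X : Type u
  [ms : MetricSpace X]
  nontrivial : Nontrivial X
  geodesic : ∀ x y : X, ∃ f : ℝ → X, f 0 = x ∧ f (dist x y) = y ∧
    ∀ s ∈ Set.Icc (0 : ℝ) (dist x y), ∀ t ∈ Set.Icc (0 : ℝ) (dist x y),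
      dist (f s) (f t) = |s - t|
  unique_arc : ∀ (x y : X) (γ : Set.Icc (0 : ℝ) 1 → X), Continuous γ →
    Function.Injective γ → γ ⟨0, by constructor <;> norm_num⟩ = x →
    γ ⟨1, by constructor <;> norm_num⟩ = y →
    ∀ z ∈ Set.range γ, dist x z + dist z y = dist x y
  act : G →* Equiv.Perm X
  isom : ∀ g : G, Isometry (act g)
  minimal : ∀ S : Set X, S.Nonempty → (∀ (g : G), ∀ x ∈ S, act g x ∈ S) →
    (∀ x ∈ S, ∀ y ∈ S, ∀ z : X, dist x z + dist z y = dist x y → z ∈ S) →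
    S = Set.univ

attribute [instance] RGTree.ms

variable {G}

namespace RGTree

variable (R : RGTree G)

/-- `z` lies between `x` and `y` (i.e. on the arc from `x` to `y`). -/
def Btw (x z y : R.X) : Prop := dist x z + dist z y = dist x y

/-- A subgroup is elliptic if it fixes a point. -/
def Elliptic (H : Subgroup G) : Prop := ∃ x : R.X, ∀ h ∈ H, R.act h x = x

/-- A hyperbolic element fixes no point. -/
def Hyperbolic (g : G) : Prop := ∀ x : R.X, R.act g x ≠ x

/-- The translation length of `g`. -/
noncomputable def ell (g : G) : ℝ :=
  sInf {r : ℝ | ∃ x : R.X, r = dist x (R.act g x)}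

/-- The characteristic set of `g`: its axis if `g` is hyperbolic, its fixed point set
if `g` is elliptic. -/
def Axis (g : G) : Set R.X := {x : R.X | dist x (R.act g x) = R.ell g}

/-- The fixed point set of `g`. -/
def Fix (g : G) : Set R.X := {x : R.X | R.act g x = x}

/-- The fixed point set of a subgroup. -/
def FixSub (H : Subgroup G) : Set R.X := {x : R.X | ∀ h ∈ H, R.act h x = x}

/-- Irreducibility: two hyperbolic elements with disjoint characteristic sets. -/
def Irr : Prop :=
  ∃ g h : G, R.Hyperbolic g ∧ R.Hyperbolic h ∧ R.Axis g ∩ R.Axis h = ∅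

/-- The distance between the characteristic sets of `g` and `h`. -/
noncomputable def axesDist (g h : G) : ℝ :=
  sInf {r : ℝ | ∃ x ∈ R.Axis g, ∃ y ∈ R.Axis h, r = dist x y}

end RGTree

/-- `f` realizes the metric simplicial `G`-tree `T` inside the `ℝ`-tree `R`. -/
def IsRealizationMap (R : RGTree G) (T : MGTree G) (f : T.V → R.X) : Prop :=
  (∀ (g : G) (v : T.V), f (T.act g v) = R.act g (f v)) ∧
  (∀ u v : T.V, dist (f u) (f v) = T.dist u v) ∧
  ∀ x : R.X, ∃ u v : T.V, T.graph.Adj u v ∧ R.Btw (f u) x (f v)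

/-- The `ℝ`-tree `R` is (equivariantly isometric to) the geometric realization of the
metric simplicial `G`-tree `T`. -/
def RealizationOf (R : RGTree G) (T : MGTree G) : Prop := ∃ f : T.V → R.X, IsRealizationMap R T f

variable (G)

/-- The equivariant Gromov–Hausdorff topology on the space of `ℝ`-trees. -/
noncomputable def gromovTopR : TopologicalSpace (RGTree G) where
  IsOpen U := ∀ R ∈ U, ∃ (X : Finset R.X) (A : Finset G) (ε : ℝ), 0 < ε ∧
    {R' : RGTree G | ∃ f : R.X → R'.X, ∀ x ∈ X, ∀ y ∈ X, ∀ g ∈ A,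
      |dist x (R.act g y) - dist (f x) (R'.act g (f y))| < ε} ⊆ U
  isOpen_univ := fun R _ => ⟨∅, ∅, 1, one_pos, Set.subset_univ _⟩
  isOpen_inter := by
    intro U V hU hV R hR
    obtain ⟨X₁, A₁, ε₁, hε₁, h₁⟩ := hU R hR.1
    obtain ⟨X₂, A₂, ε₂, hε₂, h₂⟩ := hV R hR.2
    refine ⟨X₁ ∪ X₂, A₁ ∪ A₂, min ε₁ ε₂, lt_min hε₁ hε₂, ?_⟩
    rintro R' ⟨f, hf⟩
    constructor
    · exact h₁ ⟨f, fun x hx y hy g hg =>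
        lt_of_lt_of_le (hf x (Finset.mem_union_left _ hx) y (Finset.mem_union_left _ hy) g
          (Finset.mem_union_left _ hg)) (min_le_left _ _)⟩
    · exact h₂ ⟨f, fun x hx y hy g hg =>
        lt_of_lt_of_le (hf x (Finset.mem_union_right _ hx) y (Finset.mem_union_right _ hy) g
          (Finset.mem_union_right _ hg)) (min_le_right _ _)⟩
  isOpen_sUnion := by
    intro s hs R hR
    obtain ⟨U, hUs, hRU⟩ := hR
    obtain ⟨X, A, ε, hε, h⟩ := hs U hUs R hRU
    exact ⟨X, A, ε, hε, h.trans (Set.subset_sUnion_of_mem hUs)⟩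

/-- The axes topology: the coarsest topology making all translation length functions
continuous. -/
noncomputable def axesTopR : TopologicalSpace (RGTree G) :=
  TopologicalSpace.induced (fun (R : RGTree G) (g : G) => R.ell g) Pi.topologicalSpace

variable {G}

/-- A morphism of `ℝ`-trees: an equivariant map such that every segment is a finite union
of subsegments on each of which the map is isometric. -/
structure RMorphism (R S : RGTree G) where
  f : R.X → S.X
  equivariant : ∀ (g : G) (x : R.X), f (R.act g x) = S.act g (f x)
  piecewise : ∀ x y : R.X, ∃ (n : ℕ) (c : Fin (n + 1) → R.X),
    c 0 = x ∧ c (Fin.last n) = y ∧ (∀ i : Fin (n + 1), R.Btw x (c i) y) ∧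
    ∀ i : Fin n, ∀ p q : R.X, R.Btw (c i.castSucc) p (c i.succ) →
      R.Btw (c i.castSucc) q (c i.succ) → dist (f p) (f q) = dist p q

/-- `M` is the intermediate tree at time `t` of Skora's deformation of the morphism `φ`:
the quotient of the source in which `x` and `y` are identified exactly when `φ` maps the
segment `[x,y]` into the ball of radius `t` around `φ(x) = φ(y)`. -/
def IsSkoraIntermediate {R S : RGTree G} (φ : RMorphism R S) (t : ℝ) (M : RGTree G) : Prop :=
  ∃ (p : R.X → M.X) (q : M.X → S.X), Function.Surjective p ∧
    (∀ (g : G) (x : R.X), p (R.act g x) = M.act g (p x)) ∧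
    (∀ (g : G) (m : M.X), q (M.act g m) = S.act g (q m)) ∧
    (∀ x : R.X, q (p x) = φ.f x) ∧
    (∀ x y : R.X, dist (p x) (p y) ≤ dist x y) ∧
    (∀ m m' : M.X, dist (q m) (q m') ≤ dist m m') ∧
    ∀ x y : R.X, p x = p y ↔ (φ.f x = φ.f y ∧
      ∀ z : R.X, R.Btw x z y → dist (φ.f z) (φ.f x) ≤ t)

/-- `P` is the basepoint of `R` determined by `g` and `h` (the endpoint of the
intersection of the two characteristic sets, resp. the projection of one onto the other),
characterized by the metric system (1) of [Guirardel–Levitt]. -/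
noncomputable def IsBasepoint (R : RGTree G) (g h : G) (P : R.X) : Prop :=
  dist P (R.act g P) = R.ell g ∧
  dist P (R.act h P) = R.ell h + 2 * R.axesDist g h ∧
  dist (R.act g P) (R.act h P) = R.ell g + R.ell h + 2 * R.axesDist g h ∧
  dist (R.act g P) (R.act h⁻¹ P) = R.ell g + R.ell h + 2 * R.axesDist g h

/-- `p` is a projection of `x` to the set `S` (a closest point of `S`). -/
def IsProj (R : RGTree G) (x : R.X) (S : Set R.X) (p : R.X) : Prop :=
  p ∈ S ∧ ∀ q ∈ S, dist x p ≤ dist x q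

/-- Equivariant isometry of `ℝ`-trees. -/
def RIsom (R R' : RGTree G) : Prop :=
  ∃ e : R.X ≃ R'.X, (∀ (g : G) (x : R.X), e (R.act g x) = R'.act g (e x)) ∧
    ∀ x y : R.X, dist (e x) (e y) = dist x y

/-- Equivariant homothety of `ℝ`-trees, with ratio `c`. -/
def RHomothety (c : ℝ) (R R' : RGTree G) : Prop :=
  ∃ e : R.X ≃ R'.X, (∀ (g : G) (x : R.X), e (R.act g x) = R'.act g (e x)) ∧
    ∀ x y : R.X, dist (e x) (e y) = c * dist x y

end RealTrees
section MoreDefs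

variable {G : Type u} [Group G]

/-- `H` is contained in a conjugate of `K`. -/
def ConjLe (H K : Subgroup G) : Prop := ∃ g : G, ∀ h ∈ H, g * h * g⁻¹ ∈ K

/-- `H` represents a maximal element of the vertical set `ℳ` associated to the
deformation space of `T₀`. -/
def MaxVert (T₀ : GTree G) (H : Subgroup G) : Prop :=
  T₀.Elliptic H ∧ ∀ K : Subgroup G, T₀.Elliptic K → ConjLe H K → ConjLe K H

/-- The vertical set `ℳ`: equivalence classes of maximal elements for containment in a
conjugate, among elliptic subgroups. -/
def vertSet (T₀ : GTree G) : Type u :=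
  Quot (fun H K : {H : Subgroup G // MaxVert T₀ H} => ConjLe H.1 K.1 ∧ ConjLe K.1 H.1)

namespace GTree

variable (T : GTree G)

/-- The set of `G`-orbits of vertices (the vertices of the quotient graph `T/G`). -/
def vertexOrbits : Type u := Quot (fun u v : T.V => ∃ g : G, T.act g u = v)

/-- Orbits of neighbours of `v` under the stabilizer of `v`: the oriented edges of the
quotient graph of groups issued from the image of `v`, whose number is the valence of
the image of `v`. -/
def nbrOrbits (v : T.V) : Type u :=
  Quot (fun a b : {w : T.V // T.graph.Adj v w} => ∃ g : G, T.act g v = v ∧ T.act g a.1 = b.1)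

/-- The set of `G`-orbits of (non-oriented) edges. -/
def edgeOrbits : Type u :=
  Quot (fun d d' : T.graph.Dart => ∃ g : G, T.dartAct g d = d' ∨ T.dartAct g d = d'.symm)

/-- BF-reduced: if an edge-to-vertex inclusion `G_e → G_u` is onto, then the image of `u`
in the quotient graph has valence at least 3. -/
def BFReduced : Prop :=
  ∀ u w : T.V, T.graph.Adj u w → T.stab u ≤ T.stab w →
    3 ≤ Cardinal.mk (T.nbrOrbits u)

end GTree

/-- The quotient graph of groups of `T` has a strict ascending loop: an edge whose
endpoints are in the same orbit, exactly one of the two edge-to-vertex inclusions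
being onto. -/
def HasSAL (T : GTree G) : Prop :=
  ∃ u v : T.V, T.graph.Adj u v ∧ (∃ g : G, T.act g u = v) ∧
    Xor' (T.stab u ≤ T.stab v) (T.stab v ≤ T.stab u)

/-- The edge (orbit of) `uv` is a surviving edge: `T` can be made reduced by a collapse
(within its deformation space) not collapsing `uv`. -/
def Surviving (T : GTree G) (u v : T.V) : Prop :=
  ∃ (T' : GTree G) (c : T.V → T'.V), IsCollapseMap T T' c ∧ SameDef T T' ∧
    T'.Reduced ∧ c u ≠ c v

/-- Containment in a conjugate by an element of `G₀`. -/
def perLe (G₀ : Subgroup G) (H K : Subgroup G) : Prop :=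
  ∃ g ∈ G₀, ∀ h ∈ H, g * h * g⁻¹ ∈ K

/-- `H` represents a maximal element of the peripheral structure `ℳ₀` of `G₀`. -/
def PeriphMax (T₀ : GTree G) (G₀ : Subgroup G) (H : Subgroup G) : Prop :=
  H ≤ G₀ ∧ Amin T₀ H ∧
    ∀ K : Subgroup G, K ≤ G₀ → Amin T₀ K → perLe G₀ H K → perLe G₀ K H

/-- The peripheral structure `ℳ₀` of `G₀`, as a set of equivalence classes. -/
def periphSet (T₀ : GTree G) (G₀ : Subgroup G) : Type u :=
  Quot (fun H K : {H : Subgroup G // PeriphMax T₀ G₀ H} =>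
    perLe G₀ H.1 K.1 ∧ perLe G₀ K.1 H.1)

end MoreDefs
/-! ### Abstract tree metrics -/

section TreeMetrics

/-- Metric betweenness. -/
def Btwn {V : Type*} (d : V → V → ℝ) (x z y : V) : Prop := d x z + d z y = d x y

/-- A discrete tree metric. -/
structure TreeMet {V : Type*} (d : V → V → ℝ) : Prop where
  self : ∀ x, d x x = 0
  pos : ∀ x y, x ≠ y → 0 < d x y
  symm : ∀ x y, d x y = d y x
  four : ∀ x y z w, d x y + d z w ≤ d x z + d y w ∨ d x y + d z w ≤ d x w + d y z
  med : ∀ x y z, ∃ m, Btwn d x m y ∧ Btwn d y m z ∧ Btwn d x m z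
  fin : ∀ x y, {z | Btwn d x z y}.Finite

theorem isPath_append_of_meet {V : Type*} {G : SimpleGraph V} {x m y : V} (q : G.Walk x m)
    (r : G.Walk m y) (hq : q.IsPath) (hr : r.IsPath)
    (h : ∀ w ∈ q.support, w ∈ r.support → w = m) : (q.append r).IsPath := by
  rw [SimpleGraph.Walk.isPath_def, SimpleGraph.Walk.support_append, List.nodup_append']
  have hr' := hr.support_nodup
  rw [← SimpleGraph.Walk.cons_tail_support, List.nodup_cons] at hr'
  refine ⟨hq.support_nodup, hr'.2, ?_⟩
  intro w hw hw'
  have := h w hw (List.mem_of_mem_tail hw')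
  subst this
  exact hr'.1 hw'

theorem exists_first_hit {V : Type*} {G : SimpleGraph V} (S : Set V) {z x : V}
    (p : G.Walk z x) (hx : x ∈ S) :
    ∃ m ∈ S, ∃ q : G.Walk z m, ∀ w ∈ q.support, w ∈ S → w = m := by
  induction p with
  | nil => exact ⟨_, hx, .nil, by simp⟩
  | @cons a b c h p ih =>
    by_cases ha : a ∈ S
    · exact ⟨a, ha, .nil, by simp⟩
    · obtain ⟨m, hm, q, hq⟩ := ih hx
      refine ⟨m, hm, .cons h q, ?_⟩
      intro w hw hwS
      rw [SimpleGraph.Walk.support_cons, List.mem_cons] at hw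
      rcases hw with rfl | hw
      · exact absurd hwS ha
      · exact hq w hw hwS

namespace MGTree
variable {G : Type u} [Group G] (T : MGTree G)

theorem path_uniq {x y : T.V} {p q : T.graph.Walk x y} (hp : p.IsPath) (hq : q.IsPath) : p = q :=
  (T.isTree.existsUnique_path x y).unique hp hq

theorem dist_eq {x y : T.V} {p : T.graph.Walk x y} (hp : p.IsPath) : T.dist x y = T.walkLen p := by
  have : {r : ℝ | ∃ p : T.graph.Walk x y, p.IsPath ∧ r = T.walkLen p} = {T.walkLen p} := by
    ext r
    constructor
    · rintro ⟨q, hq, rfl⟩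
      rw [T.path_uniq hq hp]; rfl
    · rintro rfl
      exact ⟨p, hp, rfl⟩
  rw [MGTree.dist, this, csInf_singleton]

theorem exists_path (x y : T.V) : ∃ p : T.graph.Walk x y, p.IsPath :=
  (T.isTree.existsUnique_path x y).exists

theorem walkLen_append {x y z : T.V} (p : T.graph.Walk x y) (q : T.graph.Walk y z) :
    T.walkLen (p.append q) = T.walkLen p + T.walkLen q := by
  simp [walkLen]

theorem btwn_of_mem {x y z : T.V} {p : T.graph.Walk x y} (hp : p.IsPath) (hz : z ∈ p.support) :
    Btwn T.dist x z y := by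
  obtain ⟨q, r, hq, hr, rfl⟩ := hp.mem_support_iff_exists_append.1 hz
  rw [Btwn, T.dist_eq hp, T.dist_eq hq, T.dist_eq hr, T.walkLen_append]

theorem dist_self' (x : T.V) : T.dist x x = 0 := by
  rw [T.dist_eq (SimpleGraph.Walk.IsPath.nil (u := x))]; simp [walkLen]

theorem walkLen_nonneg {x y : T.V} (p : T.graph.Walk x y) : 0 ≤ T.walkLen p := by
  apply List.sum_nonneg
  intro r hr
  obtain ⟨d, _, rfl⟩ := List.mem_map.1 hr
  exact (T.len_pos _ _ d.adj).le

theorem dist_pos' (x y : T.V) (h : x ≠ y) : 0 < T.dist x y := by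
  obtain ⟨p, hp⟩ := T.exists_path x y
  rw [T.dist_eq hp]
  cases p with
  | nil => exact absurd rfl h
  | cons h' p =>
    have h1 := T.walkLen_nonneg p
    have h2 := T.len_pos _ _ h'
    simp only [walkLen, SimpleGraph.Walk.darts_cons, List.map_cons, List.sum_cons] at *
    linarith

theorem dist_symm' (x y : T.V) : T.dist x y = T.dist y x := by
  obtain ⟨p, hp⟩ := T.exists_path x y
  rw [T.dist_eq hp, T.dist_eq hp.reverse]
  simp only [walkLen, SimpleGraph.Walk.darts_reverse, List.map_reverse, List.sum_reverse,
    List.map_map]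
  congr 1
  apply List.map_congr_left
  intro d _
  simp [T.len_symm d.toProd.1 d.toProd.2]

theorem exists_med (x y z : T.V) : ∃ m : T.V,
    (∃ p : T.graph.Walk x y, p.IsPath ∧ m ∈ p.support) ∧
    (∃ p : T.graph.Walk z x, p.IsPath ∧ m ∈ p.support) ∧
    (∃ p : T.graph.Walk z y, p.IsPath ∧ m ∈ p.support) := by
  obtain ⟨p, hp⟩ := T.exists_path x y
  obtain ⟨r, hr⟩ := T.exists_path z x
  obtain ⟨m, hm, q, hq⟩ := exists_first_hit {w | w ∈ p.support} r (by simp)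
  obtain ⟨p1, p2, h1, h2, rfl⟩ := hp.mem_support_iff_exists_append.1 hm
  refine ⟨m, ⟨_, hp, hm⟩, ⟨q.bypass.append p1.reverse, ?_, by simp⟩,
    ⟨q.bypass.append p2, ?_, by simp⟩⟩
  · refine isPath_append_of_meet _ _ q.bypass_isPath h1.reverse ?_
    intro w hw hw'
    refine hq w (q.support_bypass_subset_support hw) ?_
    simp only [SimpleGraph.Walk.support_reverse, List.mem_reverse] at hw'
    exact SimpleGraph.Walk.mem_support_append_iff _ _ |>.2 (Or.inl hw')
  · refine isPath_append_of_meet _ _ q.bypass_isPath h2 ?_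
    intro w hw hw'
    exact hq w (q.support_bypass_subset_support hw)
      (SimpleGraph.Walk.mem_support_append_iff _ _ |>.2 (Or.inr hw'))

theorem mem_iff_btwn {x y z : T.V} {p : T.graph.Walk x y} (hp : p.IsPath) :
    z ∈ p.support ↔ Btwn T.dist x z y := by
  refine ⟨T.btwn_of_mem hp, fun h => ?_⟩
  obtain ⟨m, ⟨p1, hp1, h1⟩, ⟨p2, hp2, h2⟩, ⟨p3, hp3, h3⟩⟩ := T.exists_med x y z
  have e1 := T.btwn_of_mem hp1 h1
  have e2 := T.btwn_of_mem hp2 h2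
  have e3 := T.btwn_of_mem hp3 h3
  by_cases hm : z = m
  · subst hm
    rw [T.path_uniq hp hp1]; exact h1
  · exfalso
    have := T.dist_pos' _ _ hm
    unfold Btwn at *
    have s1 := T.dist_symm' x z
    have s2 := T.dist_symm' x m
    linarith

theorem tm : TreeMet T.dist := by
  have hmed : ∀ x y z, ∃ m, Btwn T.dist x m y ∧ Btwn T.dist y m z ∧ Btwn T.dist x m z := by
    intro x y z
    obtain ⟨m, ⟨p1, hp1, h1⟩, ⟨p2, hp2, h2⟩, ⟨p3, hp3, h3⟩⟩ := T.exists_med x y z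
    refine ⟨m, T.btwn_of_mem hp1 h1, ?_, ?_⟩
    · exact T.btwn_of_mem hp3.reverse (by simpa using h3)
    · exact T.btwn_of_mem hp2.reverse (by simpa using h2)
  have hsub : ∀ x y w m, Btwn T.dist x m y → Btwn T.dist x m w ∨ Btwn T.dist w m y := by
    intro x y w m h
    obtain ⟨p, hp⟩ := T.exists_path x w
    obtain ⟨q, hq⟩ := T.exists_path w y
    have h1 := (T.mem_iff_btwn (p.append q).bypass_isPath).2 h
    have h2 := SimpleGraph.Walk.support_bypass_subset_support _ h1
    rcases (SimpleGraph.Walk.mem_support_append_iff _ _).1 h2 with h3 | h3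
    · exact Or.inl (T.btwn_of_mem hp h3)
    · exact Or.inr (T.btwn_of_mem hq h3)
  have htri : ∀ x y z, T.dist x z ≤ T.dist x y + T.dist y z := by
    intro x y z
    obtain ⟨m, h1, h2, h3⟩ := hmed x y z
    unfold Btwn at *
    have : 0 ≤ T.dist m y := by
      by_cases h : m = y
      · rw [h, T.dist_self']
      · exact (T.dist_pos' _ _ h).le
    have := T.dist_symm' m y
    linarith
  refine ⟨T.dist_self', T.dist_pos', T.dist_symm', ?_, hmed, ?_⟩
  · intro x y z w
    obtain ⟨m, h1, h2, h3⟩ := hmed x y z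
    have ht := htri z m w
    have s := T.dist_symm'
    rcases hsub x y w m h1 with h4 | h4
    · right
      unfold Btwn at *
      linarith [s x y, s x m, s y m, s z m, s w m, s x z, s y z, s x w, s y w, s z w]
    · left
      unfold Btwn at *
      linarith [s x y, s x m, s y m, s z m, s w m, s x z, s y z, s x w, s y w, s z w]
  · intro x y
    obtain ⟨p, hp⟩ := T.exists_path x y
    refine (List.finite_toSet p.support).subset ?_
    intro z hz
    exact (T.mem_iff_btwn hp).2 hz

theorem dist_adj {x y : T.V} (h : T.graph.Adj x y) : T.dist x y = T.len x y := by
  have : (SimpleGraph.Walk.cons h .nil).IsPath := by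
    simp [h.ne]
  rw [T.dist_eq this]
  simp [walkLen]

theorem adj_iff {x y : T.V} : T.graph.Adj x y ↔
    x ≠ y ∧ ∀ z, Btwn T.dist x z y → z = x ∨ z = y := by
  constructor
  · intro h
    refine ⟨h.ne, fun z hz => ?_⟩
    have hp : (SimpleGraph.Walk.cons h .nil).IsPath := by
      simp [h.ne]
    simpa using (T.mem_iff_btwn hp).2 hz
  · rintro ⟨hne, h⟩
    obtain ⟨p, hp⟩ := T.exists_path x y
    cases p with
    | nil => exact absurd rfl hne
    | @cons _ b _ h' p =>
      rcases h b (T.btwn_of_mem hp (by simp)) with h1 | h1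
      · subst h1; exact absurd rfl h'.ne
      · subst h1; exact h'

theorem dist_act (g : G) (x y : T.V) : T.dist (T.act g x) (T.act g y) = T.dist x y := by
  obtain ⟨p, hp⟩ := T.exists_path x y
  let φ : T.graph →g T.graph := ⟨T.act g, fun h => T.adj_act g _ _ h⟩
  have h2 : (p.map φ).IsPath := SimpleGraph.Walk.IsPath.map (T.act g).injective hp
  rw [T.dist_eq hp]
  refine (T.dist_eq h2).trans ?_
  simp only [walkLen, SimpleGraph.Walk.darts_map, List.map_map]
  congr 1
  apply List.map_congr_left
  intro d _
  exact T.len_equivariant g _ _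

end MGTree

end TreeMetrics
section TreeMetrics2

namespace TreeMet

theorem tri {V : Type*} {d : V → V → ℝ} (h : TreeMet d) (x y z : V) : d x z ≤ d x y + d y z := by
  have := h.four x z y y
  have h1 := h.self y
  have h2 := h.symm y z
  rcases this with h3 | h3 <;> linarith

theorem nonneg {V : Type*} {d : V → V → ℝ} (h : TreeMet d) (x y : V) : 0 ≤ d x y := by
  by_cases hxy : x = y
  · rw [hxy, h.self]
  · exact (h.pos x y hxy).le

theorem eq_of_le {V : Type*} {d : V → V → ℝ} (h : TreeMet d) {x y : V} (h0 : d x y ≤ 0) : x = y := by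
  by_contra hxy
  linarith [h.pos x y hxy]

theorem b_symm {V : Type*} {d : V → V → ℝ} (h : TreeMet d) {x z y : V} (hb : Btwn d x z y) : Btwn d y z x := by
  unfold Btwn at *
  linarith [h.symm x z, h.symm z y, h.symm x y]

theorem b_left {V : Type*} {d : V → V → ℝ} (h : TreeMet d) (x y : V) : Btwn d x x y := by
  unfold Btwn; rw [h.self]; ring

theorem b_right {V : Type*} {d : V → V → ℝ} (h : TreeMet d) (x y : V) : Btwn d x y y := by
  unfold Btwn; rw [h.self]; ring

theorem b_same {V : Type*} {d : V → V → ℝ} (h : TreeMet d) {x z : V} (hb : Btwn d x z x) : z = x := by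
  unfold Btwn at hb
  apply h.eq_of_le
  linarith [h.self x, h.symm x z]

theorem split {V : Type*} {d : V → V → ℝ} (h : TreeMet d) {x m y : V} (hb : Btwn d x m y) (w : V) : Btwn d x m w ∨ Btwn d w m y := by
  have s := h.symm
  unfold Btwn at *
  rcases h.four x y m w with h1 | h1
  · right
    linarith [h.tri w m y, s y w, s m w]
  · left
    linarith [h.tri x m w, s y m]

theorem b_uniq {V : Type*} {d : V → V → ℝ} (h : TreeMet d) {x y a b : V} (ha : Btwn d x a y) (hb : Btwn d x b y) (hab : d x a = d x b) :
    a = b := by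
  apply h.eq_of_le
  have s := h.symm
  unfold Btwn at *
  rcases h.four x y a b with h1 | h1 <;> linarith [s y b, s y a]

theorem med_uniq {V : Type*} {d : V → V → ℝ} (h : TreeMet d) {x y z m m' : V} (h1 : Btwn d x m y) (h2 : Btwn d y m z) (h3 : Btwn d x m z)
    (h1' : Btwn d x m' y) (h2' : Btwn d y m' z) (h3' : Btwn d x m' z) : m = m' := by
  apply h.b_uniq h1 h1'
  have s := h.symm
  unfold Btwn at *
  linarith [s m y, s m' y]

theorem concat {V : Type*} {d : V → V → ℝ} (h : TreeMet d) {x a m b : V} (h1 : Btwn d a m b) (h2 : Btwn d m a x) (hne : m ≠ a) :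
    Btwn d x m b := by
  have hp := h.pos m a hne
  have s := h.symm
  unfold Btwn at *
  rcases h.four x m a b with h3 | h3
  · linarith [s x m, s a x, s a m]
  · linarith [s x m, s a x, s a m, h.tri x m b]

theorem b_trans {V : Type*} {d : V → V → ℝ} (h : TreeMet d) {x a b y : V} (h1 : Btwn d x a y) (h2 : Btwn d x b a) :
    Btwn d x b y ∧ Btwn d b a y := by
  unfold Btwn at *
  constructor <;> linarith [h.tri x b y, h.tri b a y]

theorem seg_ind {V : Type*} {d : V → V → ℝ} (h : TreeMet d) (P : V → V → Prop) (h0 : ∀ x, P x x)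
    (h1 : ∀ x y, x ≠ y → (∀ z, Btwn d x z y → z = x ∨ z = y) → P x y)
    (h2 : ∀ x y z, Btwn d x z y → z ≠ x → z ≠ y → P x z → P z y → P x y) : ∀ x y, P x y := by
  have key : ∀ n : ℕ, ∀ x y, {z | Btwn d x z y}.ncard ≤ n → P x y := by
    intro n
    induction n with
    | zero =>
      intro x y hn
      have := (Set.ncard_eq_zero (h.fin x y)).1 (Nat.le_zero.1 hn)
      exact absurd (h.b_left x y) (by
        intro hc
        have : x ∈ {z | Btwn d x z y} := hc
        simp_all)
    | succ n ih =>
      intro x y hn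
      by_cases hxy : x = y
      · subst hxy; exact h0 x
      by_cases hadj : ∀ z, Btwn d x z y → z = x ∨ z = y
      · exact h1 x y hxy hadj
      push Not at hadj
      obtain ⟨z, hz, hzx, hzy⟩ := hadj
      refine h2 x y z hz hzx hzy (ih x z ?_) (ih z y ?_)
      · have : {w | Btwn d x w z} ⊂ {w | Btwn d x w y} := by
          refine ⟨fun w hw => (h.b_trans hz hw).1, fun hc => hzy ?_⟩
          have h3 : Btwn d x y z := hc (h.b_right x y)
          apply h.eq_of_le
          unfold Btwn at *
          linarith [h.nonneg z y, h.symm z y]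
        have := Set.ncard_lt_ncard this (h.fin x y)
        omega
      · have : {w | Btwn d z w y} ⊂ {w | Btwn d x w y} := by
          refine ⟨fun w hw => h.b_symm (h.b_trans (h.b_symm hz) (h.b_symm hw)).1, fun hc => hzx ?_⟩
          have h3 : Btwn d z x y := hc (h.b_left x y)
          apply h.eq_of_le
          unfold Btwn at *
          linarith [h.nonneg z x, h.symm z x]
        have := Set.ncard_lt_ncard this (h.fin x y)
        omega
  intro x y
  exact key _ x y le_rfl

end TreeMet

/-- The tree associated with a tree metric. -/
def metGraph {V : Type*} {d : V → V → ℝ} (h : TreeMet d) : SimpleGraph V where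
  Adj x y := x ≠ y ∧ ∀ z, Btwn d x z y → z = x ∨ z = y
  symm := ⟨fun x y hxy => ⟨hxy.1.symm, fun z hz => (hxy.2 z (h.b_symm hz)).symm⟩⟩
  loopless := ⟨fun _ hx => hx.1 rfl⟩

theorem metGraph_adj {V : Type*} {d : V → V → ℝ} (h : TreeMet d) (x y : V) :
    (metGraph h).Adj x y ↔ x ≠ y ∧ ∀ z, Btwn d x z y → z = x ∨ z = y := Iff.rfl

namespace TreeMet

theorem adj_side {V : Type*} {d : V → V → ℝ} (h : TreeMet d) {x y : V} (hxy : x ≠ y ∧ ∀ z, Btwn d x z y → z = x ∨ z = y) (w : V) :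
    Btwn d w x y ∨ Btwn d w y x := by
  obtain ⟨m, h1, h2, h3⟩ := h.med x y w
  rcases hxy.2 m h1 with rfl | rfl
  · left; exact h.b_symm h2
  · right; exact h.b_symm h3

theorem metGraph_isTree {V : Type*} {d : V → V → ℝ} (h : TreeMet d) [Nonempty V] : (metGraph h).IsTree := by
  refine ⟨⟨?_⟩, ?_⟩
  · refine h.seg_ind (fun x y => (metGraph h).Reachable x y) (fun x => .refl x) ?_ ?_
    · intro x y hxy hz
      exact SimpleGraph.Adj.reachable (G := metGraph h) ⟨hxy, hz⟩
    · intro x y z _ _ _ h1 h2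
      exact h1.trans h2
  · rw [SimpleGraph.isAcyclic_iff_forall_adj_isBridge]
    intro u v huv
    rw [SimpleGraph.isBridge_iff]
    rintro ⟨p⟩
    obtain ⟨e, -, h1, h2⟩ := p.exists_boundary_dart {z | Btwn d z u v} (h.b_left u v) (by
      intro hc
      exact huv.1 (h.b_same hc))
    have hadj := e.adj
    rw [SimpleGraph.deleteEdges_adj] at hadj
    obtain ⟨hadj, hne⟩ := hadj
    have h2' := (h.adj_side huv e.snd).resolve_left h2
    simp only [Set.mem_setOf_eq] at h1
    -- u and v lie between the endpoints of e
    have hp := h.pos u v huv.1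
    have s := h.symm
    have hb : Btwn d e.fst u e.snd ∧ Btwn d e.fst v e.snd := by
      unfold Btwn at *
      rcases h.four e.fst v u e.snd with h3 | h3 <;>
      constructor <;>
      linarith [s e.snd v, s u v, s e.fst u, s e.snd u, h.tri e.fst u e.snd, h.tri e.fst v e.snd,
        h.tri e.fst u v]
    have hu := hadj.2 u hb.1
    have hv := hadj.2 v hb.2
    rcases hu with hu | hu
    · rcases hv with hv | hv
      · exact huv.1 (hu.trans hv.symm)
      · apply hne
        rw [Set.mem_singleton_iff]
        exact congrArg₂ (fun a b => s(a, b)) hu.symm hv.symm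
    · exact h2 (hu ▸ h.b_left u v)

theorem mem_walk {V : Type*} {d : V → V → ℝ} (h : TreeMet d) {G : SimpleGraph V}
    (hG : ∀ x y, G.Adj x y → x ≠ y ∧ ∀ z, Btwn d x z y → z = x ∨ z = y)
    {u v z : V} (hz : Btwn d u z v) (p : G.Walk u v) : z ∈ p.support := by
  by_cases hu : z = u
  · subst hu; simp
  obtain ⟨e, he, h1, h2⟩ := p.exists_boundary_dart {x | ¬ Btwn d u z x}
    (fun hc => hu (h.b_same hc)) (fun hc => hc hz)
  simp only [Set.mem_setOf_eq, not_not] at h1 h2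
  have h3 := (h.split h2 e.fst).resolve_left h1
  rcases (hG _ _ e.adj).2 z h3 with h4 | h4
  · exact absurd (by rw [← h4]; exact h.b_right u z) h1
  · rw [h4]; exact p.dart_snd_mem_support_of_mem_darts he

end TreeMet

theorem MGTree.dist_eq_of {G : Type u} [Group G] (T : MGTree G) (d : T.V → T.V → ℝ)
    (h : TreeMet d)
    (hadj : ∀ x y, T.graph.Adj x y ↔ (x ≠ y ∧ ∀ z, Btwn d x z y → z = x ∨ z = y))
    (hlen : ∀ x y, T.graph.Adj x y → T.len x y = d x y) : ∀ x y, T.dist x y = d x y := by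
  refine h.seg_ind (fun x y => T.dist x y = d x y) ?_ ?_ ?_
  · intro x; rw [T.dist_self', h.self]
  · intro x y hxy hz
    have := (hadj x y).2 ⟨hxy, hz⟩
    rw [T.dist_adj this, hlen _ _ this]
  · intro x y z hz _ _ h1 h2
    obtain ⟨p, hp⟩ := T.exists_path x y
    have := T.btwn_of_mem hp (h.mem_walk (fun x y => (hadj x y).1) hz p)
    unfold Btwn at *
    linarith

end TreeMetrics2
section Basics3

namespace TreeMet

theorem b_of_le {V : Type*} {d : V → V → ℝ} (h : TreeMet d) {p q a b : V}
    (ha : Btwn d p a q) (hb : Btwn d p b q) (hab : d p a ≤ d p b) :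
    Btwn d p a b := by
  have s := h.symm
  unfold Btwn at *
  rcases h.four p q a b with h1 | h1 <;> linarith [s q b, s q a, h.tri p a b, h.nonneg a b, h.tri b a q]

end TreeMet

namespace MGTree
variable {G : Type u} [Group G] (T : MGTree G)

theorem act_mul' (g k : G) (v : T.V) : T.act (g * k) v = T.act g (T.act k v) := by
  rw [map_mul, Equiv.Perm.mul_apply]

theorem act_one' (v : T.V) : T.act 1 v = v := by
  rw [map_one, Equiv.Perm.one_apply]

theorem act_inv_act (g : G) (v : T.V) : T.act g⁻¹ (T.act g v) = v := by
  rw [← act_mul', inv_mul_cancel, act_one']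

theorem act_act_inv (g : G) (v : T.V) : T.act g (T.act g⁻¹ v) = v := by
  rw [← act_mul', mul_inv_cancel, act_one']

theorem btwn_act {x z y : T.V} (g : G) (hb : Btwn T.dist x z y) :
    Btwn T.dist (T.act g x) (T.act g z) (T.act g y) := by
  unfold Btwn at *
  rw [T.dist_act, T.dist_act, T.dist_act]; exact hb

theorem adj_act_iff {x y : T.V} (g : G) :
    T.graph.Adj (T.act g x) (T.act g y) ↔ T.graph.Adj x y := by
  constructor
  · intro h
    have := T.adj_act g⁻¹ _ _ h
    rwa [T.act_inv_act, T.act_inv_act] at this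
  · exact T.adj_act g x y

theorem minimal' (S : Set T.V) (hne : S.Nonempty) (hinv : ∀ (g : G), ∀ v ∈ S, T.act g v ∈ S)
    (hconv : ∀ u ∈ S, ∀ v ∈ S, ∀ w, Btwn T.dist u w v → w ∈ S) (z : T.V) : z ∈ S := by
  have := T.minimal S hne hinv (fun u hu v hv p hp w hw =>
    hconv u hu v hv w ((T.mem_iff_btwn hp).1 hw))
  rw [this]; trivial

theorem hull (S : Set T.V) (hne : S.Nonempty) (hinv : ∀ (g : G), ∀ v ∈ S, T.act g v ∈ S)
    (z : T.V) : ∃ s ∈ S, ∃ s' ∈ S, Btwn T.dist s z s' := by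
  have h := T.tm
  refine T.minimal' {z | ∃ s ∈ S, ∃ s' ∈ S, Btwn T.dist s z s'} ?_ ?_ ?_ z
  · obtain ⟨s, hs⟩ := hne
    exact ⟨s, s, hs, s, hs, h.b_left s s⟩
  · rintro g v ⟨s, hs, s', hs', hb⟩
    exact ⟨_, hinv g s hs, _, hinv g s' hs', T.btwn_act g hb⟩
  · rintro u hu v hv w hw
    by_cases hwu : w = u
    · rwa [hwu]
    by_cases hwv : w = v
    · rwa [hwv]
    obtain ⟨s1, hs1, s2, hs2, hb⟩ := hu
    obtain ⟨s3, hs3, s4, hs4, hb'⟩ := hv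
    have e1 : ∃ s ∈ S, Btwn T.dist w u s := by
      rcases h.split hb w with h1 | h1
      · exact ⟨s1, hs1, h.b_symm h1⟩
      · exact ⟨s2, hs2, h1⟩
    have e2 : ∃ s ∈ S, Btwn T.dist w v s := by
      rcases h.split hb' w with h1 | h1
      · exact ⟨s3, hs3, h.b_symm h1⟩
      · exact ⟨s4, hs4, h1⟩
    obtain ⟨s, hs, e1⟩ := e1
    obtain ⟨s', hs', e2⟩ := e2
    have e3 := h.concat hw e1 hwu
    have e4 := h.concat (h.b_symm e3) e2 hwv
    exact ⟨s', hs', s, hs, e4⟩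

theorem cofinite [Group.FG G] : ∃ R : Finset T.V, ∀ z : T.V, ∃ g : G, ∃ r ∈ R, T.act g r = z := by
  have h := T.tm
  obtain ⟨S, hS⟩ := (Group.fg_def (G := G)).1 inferInstance
  obtain ⟨v0⟩ := T.nonempty
  set R : Set T.V := {v0} ∪ ⋃ s ∈ S, {z | Btwn T.dist v0 z (T.act s v0)} with hR
  have hfin : R.Finite := by
    refine (Set.finite_singleton v0).union ?_
    exact Set.Finite.biUnion S.finite_toSet (fun s _ => h.fin _ _)
  have key : ∀ g : G, ∀ z, Btwn T.dist v0 z (T.act g v0) → ∃ k : G, ∃ r ∈ R, T.act k r = z := by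
    intro g
    have hg : g ∈ Subgroup.closure (S : Set G) := by rw [hS]; trivial
    induction hg using Subgroup.closure_induction with
    | mem s hs =>
      intro z hz
      exact ⟨1, z, Or.inr (Set.mem_biUnion hs hz), T.act_one' z⟩
    | one =>
      intro z hz
      rw [T.act_one'] at hz
      exact ⟨1, v0, Or.inl rfl, by rw [T.act_one', h.b_same hz]⟩
    | mul a b _ _ iha ihb =>
      intro z hz
      rcases h.split hz (T.act a v0) with h1 | h1
      · exact iha z h1
      · rw [T.act_mul'] at h1
        have := T.btwn_act a⁻¹ h1
        rw [T.act_inv_act, T.act_inv_act] at this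
        obtain ⟨k, r, hr, hk⟩ := ihb _ this
        exact ⟨a * k, r, hr, by rw [T.act_mul', hk, T.act_act_inv]⟩
    | inv a _ iha =>
      intro z hz
      have := T.btwn_act a (h.b_symm hz)
      rw [T.act_act_inv] at this
      obtain ⟨k, r, hr, hk⟩ := iha _ this
      exact ⟨a⁻¹ * k, r, hr, by rw [T.act_mul', hk, T.act_inv_act]⟩
  refine ⟨hfin.toFinset, fun z => ?_⟩
  obtain ⟨s, ⟨g, rfl⟩, s', ⟨g', rfl⟩, hb⟩ := T.hull (Set.range (fun g : G => T.act g v0))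
    ⟨_, 1, rfl⟩ (by rintro g _ ⟨k, rfl⟩; exact ⟨g * k, T.act_mul' _ _ _⟩) z
  have := T.btwn_act g⁻¹ hb
  simp only at this
  rw [T.act_inv_act, ← T.act_mul'] at this
  obtain ⟨k, r, hr, hk⟩ := key _ _ this
  exact ⟨g * k, r, by simpa using hr, by rw [T.act_mul', hk, T.act_act_inv]⟩

/-- representatives -/
theorem exists_rep [Group.FG G] : ∃ (rep : T.V → T.V) (mv : T.V → G),
    (Set.range rep).Finite ∧ (∀ v, T.act (mv v) (rep v) = v) ∧
    (∀ g v, rep (T.act g v) = rep v) ∧ ∀ v, rep (rep v) = rep v := by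
  let s : Setoid T.V :=
    { r := fun x y => ∃ g : G, T.act g x = y
      iseqv := ⟨fun x => ⟨1, T.act_one' x⟩,
        fun {x y} ⟨g, hg⟩ => ⟨g⁻¹, by rw [← hg, T.act_inv_act]⟩,
        fun {x y z} ⟨g, hg⟩ ⟨k, hk⟩ => ⟨k * g, by rw [T.act_mul', hg, hk]⟩⟩ }
  let rep : T.V → T.V := fun v => (Quotient.mk s v).out
  have h1 : ∀ v, ∃ g : G, T.act g (rep v) = v := fun v => Quotient.mk_out (s := s) v
  have h2 : ∀ g v, rep (T.act g v) = rep v := by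
    intro g v
    have : Quotient.mk s (T.act g v) = Quotient.mk s v :=
      Quotient.sound (s := s) ⟨g⁻¹, T.act_inv_act g v⟩
    simp only [rep, this]
  choose mv hmv using h1
  refine ⟨rep, mv, ?_, hmv, h2, ?_⟩
  · obtain ⟨R, hR⟩ := T.cofinite
    refine (R.finite_toSet.image rep).subset ?_
    rintro _ ⟨v, rfl⟩
    obtain ⟨g, r, hr, rfl⟩ := hR v
    exact ⟨r, hr, (h2 g r).symm⟩
  · intro v
    have := h2 (mv v) (rep v)
    rw [hmv] at this
    exact this.symm

theorem fixed_btwn {p q n : T.V} (g : G) (hp : T.act g p = p) (hq : T.act g q = q)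
    (hn : Btwn T.dist p n q) : T.act g n = n := by
  have h1 := T.btwn_act g hn
  rw [hp, hq] at h1
  refine T.tm.b_uniq h1 hn ?_
  have := T.dist_act g p n
  rwa [hp] at this

theorem lemmaB (A : Finset G) (x q : T.V) (ε : ℝ) (hε : 0 < ε)
    (hq : ∀ g ∈ A, T.act g q = q) (hx : ∀ g ∈ A, T.dist x (T.act g x) < ε) :
    ∃ p, (∀ g ∈ A, T.act g p = p) ∧ T.dist x p < ε := by
  have h := T.tm
  obtain ⟨p, ⟨hpf, hpb⟩, hmin⟩ := Set.exists_min_image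
    {p | (∀ g ∈ A, T.act g p = p) ∧ Btwn T.dist x p q} (fun p => T.dist x p)
    ((h.fin x q).subset (fun p hp => hp.2)) ⟨q, hq, h.b_right x q⟩
  refine ⟨p, hpf, ?_⟩
  by_cases hpx : p = x
  · rw [hpx, h.self]; exact hε
  choose m hm1 hm2 hm3 using fun g : G => h.med p x (T.act g x)
  have hmfix : ∀ g ∈ A, T.act g (m g) = m g := by
    intro g hg
    have e1 := T.btwn_act g (hm1 g)
    rw [hpf g hg] at e1
    refine h.b_uniq e1 (hm3 g) ?_
    have := T.dist_act g p (m g)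
    rwa [hpf g hg] at this
  obtain ⟨n, hnS, hnmin⟩ := Set.exists_min_image (insert x (m '' (A : Set G)))
    (fun z => T.dist p z) ((A.finite_toSet.image m).insert x) ⟨x, Set.mem_insert _ _⟩
  have hnb : Btwn T.dist p n x := by
    rcases hnS with rfl | ⟨g, _, rfl⟩
    · exact h.b_right _ _
    · exact hm1 g
  have hnfix : ∀ g ∈ A, T.act g n = n := by
    intro g hg
    have e1 := hnmin (m g) (Or.inr ⟨g, hg, rfl⟩)
    exact T.fixed_btwn g (hpf g hg) (hmfix g hg) (h.b_of_le hnb (hm1 g) e1)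
  have hnq := (h.b_trans hpb (h.b_symm hnb)).1
  have e2 := hmin n ⟨hnfix, hnq⟩
  have hnp : n = p := by
    apply h.eq_of_le
    have s := h.symm
    unfold Btwn at hnb
    linarith [s n p, s x p, s x n]
  rcases hnS with hc | ⟨g, hg, hc⟩
  · exact absurd (hnp.symm.trans hc) hpx
  · have e3 := hm2 g
    rw [hc, hnp] at e3
    have e4 := hx g hg
    have e5 := T.dist_act g p x
    rw [hpf g hg] at e5
    unfold Btwn at e3
    linarith [h.nonneg x p, h.symm x p]

theorem lemmaA [Group.FG G] (hfg : ∀ v : T.V, (T.stab v).FG) (F : Finset T.V) (δ : ℝ)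
    (hδ : 0 < δ) : ∃ (X : Finset T.V) (A : Finset G) (ε : ℝ), 0 < ε ∧ ∀ T' : MGTree G,
      (∀ H : Subgroup G, T.Elliptic H → T'.Elliptic H) → T' ∈ gromovBasic G T X A ε →
      ∃ f : T.V → T'.V, (∀ g v, f (T.act g v) = T'.act g (f v)) ∧
        ∀ x ∈ F, ∀ y ∈ F, |T.dist x y - T'.dist (f x) (f y)| < δ := by
  obtain ⟨rep, mv, hfin, hmv, hrep, hrr⟩ := T.exists_rep
  choose gen hgen using hfg
  refine ⟨hfin.toFinset, (F ×ˢ F).image (fun q => (mv q.1)⁻¹ * mv q.2) ∪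
    hfin.toFinset.biUnion gen, δ / 3, by positivity, ?_⟩
  rintro T' hell ⟨f0, hf0⟩
  have hp : ∀ r : T.V, ∃ p : T'.V, r ∈ Set.range rep →
      (∀ g, T.act g r = r → T'.act g p = p) ∧ T'.dist (f0 r) p < δ / 3 := by
    intro r
    by_cases hr : r ∈ Set.range rep
    swap
    · exact ⟨f0 r, fun hc => absurd hc hr⟩
    have hr' : r ∈ hfin.toFinset := by simpa using hr
    obtain ⟨q, hq⟩ := hell (T.stab r) ⟨r, fun g hg => hg⟩
    have hmem : ∀ g ∈ gen r, g ∈ T.stab r := by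
      intro g hg
      rw [← hgen r]; exact Subgroup.subset_closure hg
    obtain ⟨p, hpf, hpd⟩ := T'.lemmaB (gen r) (f0 r) q (δ / 3) (by positivity)
      (fun g hg => hq g (hmem g hg)) (by
        intro g hg
        have h1 := hf0 r hr' r hr' g
          (Finset.mem_union_right _ (Finset.mem_biUnion.2 ⟨r, hr', hg⟩))
        have h2 : T.act g r = r := hmem g hg
        rw [h2, T.tm.self] at h1
        rw [abs_lt] at h1
        linarith)
    refine ⟨p, fun _ => ⟨?_, hpd⟩⟩
    have : T.stab r ≤ T'.stab p := by
      rw [← hgen r, Subgroup.closure_le]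
      exact fun g hg => hpf g hg
    exact fun g hg => this hg
  choose p hp using hp
  refine ⟨fun v => T'.act (mv v) (p (rep v)), ?_, ?_⟩
  · intro g v
    have h1 := (hp (rep v) ⟨v, rfl⟩).1 ((mv (T.act g v))⁻¹ * (g * mv v)) (by
      rw [T.act_mul', T.act_mul', hmv]
      have := hmv (T.act g v)
      rw [hrep] at this
      exact (congrArg (T.act (mv (T.act g v))⁻¹) this.symm).trans (T.act_inv_act _ _))
    simp only [hrep]
    conv_lhs => rw [← h1]
    rw [← T'.act_mul', ← T'.act_mul']
    congr 2
    group
  · intro x hx y hy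
    have hrx : rep x ∈ hfin.toFinset := by simp
    have hry : rep y ∈ hfin.toFinset := by simp
    have h1 := hf0 _ hrx _ hry ((mv x)⁻¹ * mv y) (Finset.mem_union_left _
      (Finset.mem_image.2 ⟨(x, y), Finset.mem_product.2 ⟨hx, hy⟩, rfl⟩))
    have h2 : T.dist (rep x) (T.act ((mv x)⁻¹ * mv y) (rep y)) = T.dist x y := by
      rw [← T.dist_act (mv x), T.act_mul', T.act_act_inv, hmv, hmv]
    have h3 : T'.dist (f0 (rep x)) (T'.act ((mv x)⁻¹ * mv y) (f0 (rep y))) =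
        T'.dist (T'.act (mv x) (f0 (rep x))) (T'.act (mv y) (f0 (rep y))) := by
      rw [← T'.dist_act (mv x), T'.act_mul', T'.act_act_inv]
    have h4 := (hp (rep x) ⟨x, rfl⟩).2
    have h5 := (hp (rep y) ⟨y, rfl⟩).2
    rw [← T'.dist_act (mv x)] at h4
    rw [← T'.dist_act (mv y)] at h5
    rw [h2, h3] at h1
    have tm := T'.tm
    have s := tm.symm
    rw [abs_lt] at h1 ⊢
    simp only
    generalize T'.act (mv x) (f0 (rep x)) = a at *
    generalize T'.act (mv y) (f0 (rep y)) = b at *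
    generalize T'.act (mv x) (p (rep x)) = a' at *
    generalize T'.act (mv y) (p (rep y)) = b' at *
    constructor <;> linarith [tm.tri a a' b, tm.tri a' b' b, tm.tri a' a b', tm.tri a b b', s a a', s b b']

end MGTree
end Basics3
section LemmaC

namespace MGTree
variable {G : Type u} [Group G]

theorem exists_next (T : MGTree G) {v x : T.V} (hvx : v ≠ x) :
    ∃ b, T.graph.Adj v b ∧ Btwn T.dist v b x := by
  have h := T.tm
  obtain ⟨b, ⟨hb, hbv⟩, hmin⟩ := Set.exists_min_image {z | Btwn T.dist v z x ∧ z ≠ v}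
    (fun z => T.dist v z) ((h.fin v x).subset (fun z hz => hz.1)) ⟨x, h.b_right v x, hvx.symm⟩
  refine ⟨b, T.adj_iff.2 ⟨hbv.symm, fun z hz => ?_⟩, hb⟩
  by_contra hc
  push Not at hc
  have h1 := hmin z ⟨(h.b_trans hb hz).1, hc.1⟩
  have h2 := h.pos z b hc.2
  unfold Btwn at hz
  linarith

theorem path_ind (T : MGTree G) (x : T.V) (P : T.V → Prop) (h0 : P x)
    (h1 : ∀ v b, T.graph.Adj v b → Btwn T.dist v b x → P b → P v) : ∀ v, P v := by
  have h := T.tm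
  have key : ∀ n : ℕ, ∀ v, {z | Btwn T.dist v z x}.ncard ≤ n → P v := by
    intro n
    induction n with
    | zero =>
      intro v hn
      have h2 := (Set.ncard_eq_zero (h.fin v x)).1 (Nat.le_zero.1 hn)
      have h3 : v ∈ {z | Btwn T.dist v z x} := h.b_left v x
      rw [h2] at h3
      exact absurd h3 (Set.notMem_empty v)
    | succ n ih =>
      intro v hn
      by_cases hvx : v = x
      · rw [hvx]; exact h0
      obtain ⟨b, hb, hbx⟩ := T.exists_next hvx
      refine h1 v b hb hbx (ih b ?_)
      have : {w | Btwn T.dist b w x} ⊂ {w | Btwn T.dist v w x} := by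
        refine ⟨fun w hw => h.b_symm (h.b_trans (h.b_symm hbx) (h.b_symm hw)).1, fun hc => ?_⟩
        have h3 : Btwn T.dist b v x := hc (h.b_left v x)
        have h4 := h.pos v b hb.ne
        unfold Btwn at *
        linarith [h.symm b v]
      have := Set.ncard_lt_ncard this (h.fin v x)
      omega
  exact fun v => key _ v le_rfl

theorem adj_sep (T : MGTree G) {u v x y : T.V} (huv : T.graph.Adj u v) (hxy : T.graph.Adj x y)
    (h1 : Btwn T.dist u v y) (h2 : Btwn T.dist v u x) : u = x ∧ v = y := by
  have h := T.tm
  have e1 : Btwn T.dist y v x := h.concat h2 h1 huv.ne |> fun e => by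
    have := h.concat (h.b_symm (h.b_symm h2)) (h1) huv.ne
    exact h.b_symm (h.concat (h.b_symm (h.b_symm h1)) h2 huv.ne.symm)
  have e2 : Btwn T.dist y u x := h.concat h2 h1 huv.ne
  have a1 := (T.adj_iff.1 hxy).2 v (h.b_symm e1)
  have a2 := (T.adj_iff.1 hxy).2 u (h.b_symm e2)
  have hne := huv.ne
  rcases a1 with a1 | a1 <;> rcases a2 with a2 | a2
  · exact absurd (a2.trans a1.symm) hne
  · exfalso
    rw [a1, a2] at h1
    exact hne (by rw [a2, a1]; exact (h.b_same h1).symm)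
  · exact ⟨a2, a1⟩
  · exact absurd (a2.trans a1.symm) hne

theorem collapse_of_sides (T T' : MGTree G) (f : T.V → T'.V)
    (hf : ∀ g v, f (T.act g v) = T'.act g (f v)) (Sd : T'.V → T.V → T.V → Prop)
    (hact : ∀ g w u v, Sd (T'.act g w) (T.act g u) (T.act g v) ↔ Sd w u v)
    (hswap : ∀ w u v, T.graph.Adj u v → (Sd w v u ↔ ¬ Sd w u v))
    (hsf : ∀ x u v, T.graph.Adj u v → (Sd (f x) u v ↔ Btwn T.dist u v x))
    (hconv : ∀ w w1 w2 u v, T.graph.Adj u v → Sd w1 u v → Sd w2 u v → Btwn T'.dist w1 w w2 →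
      Sd w u v)
    (hedge : ∀ w w' u v, T.graph.Adj u v → T'.graph.Adj w w' → ¬ Sd w u v → Sd w' u v →
      Btwn T'.dist (f u) w (f v) ∧ Btwn T'.dist (f u) w' (f v)) :
    CollapseOf T.toGTree T'.toGTree := by
  have h := T.tm
  have h' := T'.tm
  have uniq : ∀ w x y, (∀ u v, T.graph.Adj u v → Btwn T.dist u v x → Sd w u v) →
      (∀ u v, T.graph.Adj u v → Btwn T.dist u v y → Sd w u v) → x = y := by
    intro w x y hx hy
    by_contra hne
    obtain ⟨b, hb, hbx⟩ := T.exists_next hne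
    have h1 := hy x b hb hbx
    have h2 := hx b x hb.symm (h.b_right b x)
    exact (hswap w x b hb).1 h2 h1
  -- points over an edge
  have half : ∀ w x y, T.graph.Adj x y → Btwn T'.dist (f x) w (f y) → Sd w x y →
      ∀ u v, T.graph.Adj u v → Btwn T.dist u v y → Sd w u v := by
    intro w x y hxy hw hs u v huv hb
    by_cases hx : Btwn T.dist u v x
    · exact hconv w _ _ u v huv ((hsf x u v huv).2 hx) ((hsf y u v huv).2 hb) hw
    · have hx' : Btwn T.dist v u x := h.b_symm ((h.adj_side (T.adj_iff.1 huv) x).resolve_right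
        (fun hc => hx (h.b_symm hc)))
      obtain ⟨rfl, rfl⟩ := T.adj_sep huv hxy hb hx'
      exact hs
  have half2 : ∀ w x y, T.graph.Adj x y → Btwn T'.dist (f x) w (f y) →
      ((∀ u v, T.graph.Adj u v → Btwn T.dist u v y → Sd w u v) ∨
      (∀ u v, T.graph.Adj u v → Btwn T.dist u v x → Sd w u v)) := by
    intro w x y hxy hw
    by_cases hs : Sd w x y
    · left; exact half w x y hxy hw hs
    · right; exact half w y x hxy.symm (h'.b_symm hw) ((hswap w x y hxy).2 hs)
  have cover : ∀ w, ∃ x y, (x = y ∨ T.graph.Adj x y) ∧ Btwn T'.dist (f x) w (f y) := by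
    intro w
    obtain ⟨v0⟩ := T.nonempty
    obtain ⟨_, ⟨s, rfl⟩, _, ⟨s', rfl⟩, hb⟩ := T'.hull (Set.range f) ⟨_, v0, rfl⟩
      (by rintro g _ ⟨k, rfl⟩; exact ⟨T.act g k, hf g k⟩) w
    refine h.seg_ind (fun s s' => Btwn T'.dist (f s) w (f s') → ∃ x y, (x = y ∨ T.graph.Adj x y) ∧
      Btwn T'.dist (f x) w (f y)) ?_ ?_ ?_ s s' hb
    · intro x hx; exact ⟨x, x, Or.inl rfl, hx⟩
    · intro x y h1 h2 hx; exact ⟨x, y, Or.inr (T.adj_iff.2 ⟨h1, h2⟩), hx⟩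
    · intro x y z _ _ _ i1 i2 hx
      rcases h'.split hx (f z) with h1 | h1
      · exact i1 h1
      · exact i2 h1
  have exist : ∀ w, ∃ x, ∀ u v, T.graph.Adj u v → Btwn T.dist u v x → Sd w u v := by
    intro w
    obtain ⟨x, y, hxy, hb⟩ := cover w
    rcases hxy with rfl | hxy
    · have : w = f x := h'.b_same hb
      exact ⟨x, fun u v huv hx => by rw [this]; exact (hsf x u v huv).2 hx⟩
    · rcases half2 w x y hxy hb with h1 | h1
      · exact ⟨y, h1⟩
      · exact ⟨x, h1⟩
  choose c hc using exist
  have hcf : ∀ x, c (f x) = x := fun x => uniq (f x) _ _ (hc _) (fun u v huv => (hsf x u v huv).2)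
  have hciff : ∀ w u v, T.graph.Adj u v → (Sd w u v ↔ Btwn T.dist u v (c w)) := by
    intro w u v huv
    refine ⟨fun hs => ?_, hc w u v huv⟩
    by_contra hb
    have hb' : Btwn T.dist v u (c w) := h.b_symm ((h.adj_side (T.adj_iff.1 huv) (c w)).resolve_right
        (fun hc => hb (h.b_symm hc)))
    exact (hswap w u v huv).1 (hc w v u huv.symm hb') hs
  have hcedge : ∀ w x y, T.graph.Adj x y → Btwn T'.dist (f x) w (f y) → c w = y ∨ c w = x := by
    intro w x y hxy hw
    rcases half2 w x y hxy hw with h1 | h1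
    · exact Or.inl (uniq w _ _ (hc w) h1)
    · exact Or.inr (uniq w _ _ (hc w) h1)
  refine ⟨c, ?_, ?_, ?_, ?_, ?_⟩
  · intro g w
    refine uniq (T'.act g w) _ _ (hc _) ?_
    intro u v huv hb
    have h1 := T.btwn_act g⁻¹ hb
    rw [T.act_inv_act] at h1
    have h2 := hc w _ _ (T.adj_act g⁻¹ u v huv) h1
    rw [← hact g, T.act_act_inv, T.act_act_inv] at h2
    exact h2
  · intro x; exact ⟨f x, hcf x⟩
  · intro w w' hww hne
    obtain ⟨b, hb, hbx⟩ := T.exists_next hne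
    have h1 : Sd w' (c w) b := hc w' _ _ hb hbx
    have h2 : ¬ Sd w (c w) b := by
      rw [hciff _ _ _ hb]
      intro hcon
      exact hb.ne (h.b_same hcon).symm
    have h3 := (hedge w w' (c w) b hb hww h2 h1).2
    rcases hcedge w' _ _ hb h3 with h4 | h4
    · rw [h4]; exact hb
    · exact absurd h4.symm hne
  · intro u v huv
    obtain ⟨p, -⟩ := T'.exists_path (f u) (f v)
    obtain ⟨e, -, h1, h2⟩ := p.exists_boundary_dart {z | ¬ Sd z u v}
      (by
        intro hcon
        have := (hsf u u v huv).1 hcon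
        exact huv.ne (h.b_same this).symm)
      (fun hcon => hcon ((hsf v u v huv).2 (h.b_right u v)))
    have h1 : ¬ Sd e.fst u v := h1
    have h2 : Sd e.snd u v := not_not.1 h2
    have h3 := hedge _ _ u v huv e.adj h1 h2
    refine ⟨e.fst, e.snd, e.adj, ?_, ?_⟩
    · rcases hcedge _ _ _ huv h3.1 with h4 | h4
      · exfalso
        apply h1
        rw [hciff _ _ _ huv, h4]
        exact h.b_right u v
      · exact h4
    · rcases hcedge _ _ _ huv h3.2 with h4 | h4
      · exact h4
      · exfalso
        rw [hciff _ _ _ huv, h4] at h2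
        exact huv.ne (h.b_same h2).symm
  · intro a b hab p hp w hw
    have hw' := (T'.mem_iff_btwn hp).1 hw
    refine uniq w _ _ (hc w) ?_
    intro u v huv hb
    exact hconv w a b u v huv (hc a u v huv hb) (hc b u v huv (by rw [← hab]; exact hb)) hw'

/-- `f` is locally almost isometric. -/
structure Near (T T' : MGTree G) (f : T.V → T'.V) (l δ : ℝ) : Prop where
  equi : ∀ g v, f (T.act g v) = T'.act g (f v)
  nonneg : 0 ≤ δ
  lpos : 0 < l
  small : 20 * δ ≤ l
  edge : ∀ u v, T.graph.Adj u v → l ≤ T.dist u v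
  star : ∀ v a b, (a = v ∨ T.graph.Adj v a) → (b = v ∨ T.graph.Adj v b) →
    |T.dist a b - T'.dist (f a) (f b)| ≤ δ

namespace Near
variable {T T' : MGTree G} {f : T.V → T'.V} {l δ : ℝ}

theorem edge' (N : Near T T' f l δ) {u v : T.V} (huv : T.graph.Adj u v) :
    l - δ ≤ T'.dist (f u) (f v) := by
  have h1 := abs_le.1 (N.star u u v (Or.inl rfl) (Or.inr huv))
  linarith [N.edge u v huv]

theorem gp_star (N : Near T T' f l δ) {u v b : T.V} (hu : T.graph.Adj u v)
    (hb : T.graph.Adj v b) (h : Btwn T.dist u v b) :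
    T'.dist (f u) (f v) + T'.dist (f v) (f b) - T'.dist (f u) (f b) ≤ 3 * δ := by
  have h1 := abs_le.1 (N.star v u v (Or.inr hu.symm) (Or.inl rfl))
  have h2 := abs_le.1 (N.star v v b (Or.inl rfl) (Or.inr hb))
  have h3 := abs_le.1 (N.star v u b (Or.inr hu.symm) (Or.inr hb))
  unfold Btwn at h
  linarith

theorem gp (N : Near T T' f l δ) (x : T.V) : ∀ v u : T.V, T.graph.Adj u v → Btwn T.dist u v x →
    T'.dist (f u) (f v) + T'.dist (f v) (f x) - T'.dist (f u) (f x) ≤ 3 * δ := by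
  have h := T.tm
  have h' := T'.tm
  refine T.path_ind x (fun v => ∀ u : T.V, T.graph.Adj u v → Btwn T.dist u v x →
    T'.dist (f u) (f v) + T'.dist (f v) (f x) - T'.dist (f u) (f x) ≤ 3 * δ) ?_ ?_
  · intro u _ _
    rw [h'.self]
    linarith [N.nonneg]
  · intro v b hvb hb ih u huv hu
    have h1 := ih v hvb hb
    have h2 : Btwn T.dist u v b := by
      unfold Btwn at *
      linarith [h.tri u b x, h.tri u v b]
    have h3 := N.gp_star huv hvb h2
    have h4 := N.edge' hvb
    have h5 := N.small
    have h6 := N.lpos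
    rcases h'.four (f u) (f b) (f v) (f x) with h7 | h7
    · linarith [N.nonneg]
    · linarith [h'.symm (f v) (f b)]

theorem side (N : Near T T' f l δ) {u v x : T.V} (huv : T.graph.Adj u v)
    (hx : Btwn T.dist u v x) : T'.dist (f x) (f v) + (l - 4 * δ) ≤ T'.dist (f x) (f u) := by
  have h1 := N.gp x v u huv hx
  have h2 := N.edge' huv
  linarith [T'.tm.symm (f x) (f v), T'.tm.symm (f x) (f u)]

end Near

theorem exists_orient (T : MGTree G) : ∃ O : T.V → T.V → Prop,
    (∀ g u v, O (T.act g u) (T.act g v) ↔ O u v) ∧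
    (∀ u v, T.graph.Adj u v → (O v u ↔ ¬ O u v)) := by
  let r : T.V × T.V → T.V × T.V → Prop := fun p q => ∃ g, T.act g p.1 = q.1 ∧ T.act g p.2 = q.2
  have hr : Equivalence r := by
    refine ⟨fun x => ⟨1, T.act_one' _, T.act_one' _⟩, ?_, ?_⟩
    · rintro x y ⟨g, h1, h2⟩
      exact ⟨g⁻¹, by rw [← h1, T.act_inv_act], by rw [← h2, T.act_inv_act]⟩
    · rintro x y z ⟨g, h1, h2⟩ ⟨k, h3, h4⟩
      exact ⟨k * g, by rw [T.act_mul', h1, h3], by rw [T.act_mul', h2, h4]⟩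
  let s : Setoid (T.V × T.V) := ⟨r, hr⟩
  refine ⟨fun u v => WellOrderingRel (Quotient.mk s (u, v)) (Quotient.mk s (v, u)), ?_, ?_⟩
  · intro g u v
    have h1 : ∀ a b : T.V, Quotient.mk s (T.act g a, T.act g b) = Quotient.mk s (a, b) :=
      fun a b => Quotient.sound (s := s) ⟨g⁻¹, T.act_inv_act _ _, T.act_inv_act _ _⟩
    simp only [h1]
  · intro u v huv
    have hne : Quotient.mk s (u, v) ≠ Quotient.mk s (v, u) := by
      intro hc
      obtain ⟨g, h1, h2⟩ := Quotient.exact hc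
      exact T.noInversion g u v huv ⟨h1, h2⟩
    constructor
    · intro h1 h2
      exact asymm (r := WellOrderingRel) h1 h2
    · intro h1
      rcases trichotomous_of WellOrderingRel (Quotient.mk s (u, v)) (Quotient.mk s (v, u)) with
        h2 | h2 | h2
      · exact absurd h2 h1
      · exact absurd h2 hne
      · exact h2

theorem Near.collapse {T T' : MGTree G} {f : T.V → T'.V} {l δ : ℝ} (N : Near T T' f l δ) :
    CollapseOf T.toGTree T'.toGTree := by
  have h := T.tm
  have h' := T'.tm
  obtain ⟨O, hO1, hO2⟩ := T.exists_orient
  have pos : 0 < l - 4 * δ := by linarith [N.small, N.lpos, N.nonneg]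
  let d := T'.dist
  refine collapse_of_sides T T' f N.equi (fun w u v =>
    if O u v then T'.dist w (f v) < T'.dist w (f u) else T'.dist w (f v) ≤ T'.dist w (f u))
    ?_ ?_ ?_ ?_ ?_
  · intro g w u v
    simp only [hO1, N.equi, T'.dist_act]
  · intro w u v huv
    have := hO2 u v huv
    by_cases ho : O u v
    · simp [ho, this]
    · simp [ho, this]
  · intro x u v huv
    constructor
    · intro hs
      by_contra hb
      have hb' : Btwn T.dist v u x := h.b_symm ((h.adj_side (T.adj_iff.1 huv) x).resolve_right
        (fun hc => hb (h.b_symm hc)))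
      have h1 := N.side huv.symm hb'
      split_ifs at hs <;> linarith
    · intro hb
      have h1 := N.side huv hb
      split_ifs <;> linarith
  · intro w w1 w2 u v huv h1 h2 hb
    have s := h'.symm
    unfold Btwn at hb
    have e : T'.dist w (f v) + T'.dist w1 w2 ≤ T'.dist (f v) w1 + T'.dist w w2 ∨
      T'.dist w (f v) + T'.dist w1 w2 ≤ T'.dist (f v) w2 + T'.dist w w1 := by
      rcases h'.four w (f v) w1 w2 with e | e
      · right; linarith
      · left; linarith
    have t1 := h'.tri (f u) w w1
    have t2 := h'.tri (f u) w w2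
    split_ifs at h1 h2 ⊢ <;> rcases e with e | e <;>
      linarith [s (f v) w1, s (f v) w2, s (f u) w1, s (f u) w2, s (f u) w, s w w1]
  · intro w w' u v huv hww h1 h2
    have hlt : T'.dist w (f u) - T'.dist w (f v) < T'.dist w' (f u) - T'.dist w' (f v) := by
      split_ifs at h1 h2 <;> linarith
    have s := h'.symm
    have hp := h'.pos w w' hww.ne
    have a1 := h'.adj_side (T'.adj_iff.1 hww) (f u)
    have a2 := h'.adj_side (T'.adj_iff.1 hww) (f v)
    rcases a1 with a1 | a1 <;> rcases a2 with a2 | a2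
    · exfalso; unfold Btwn at *; linarith [s w (f u), s w (f v), s w' (f u), s w' (f v)]
    · constructor
      · exact h'.b_symm (h'.concat (h'.b_symm a1) (h'.b_symm a2) hww.ne)
      · exact h'.concat (h'.b_symm a2) (h'.b_symm a1) hww.ne.symm
    · exfalso; unfold Btwn at *; linarith [s w (f u), s w (f v), s w' (f u), s w' (f v), s w w']
    · exfalso; unfold Btwn at *; linarith [s w (f u), s w (f v), s w' (f u), s w' (f v), s w w']

end MGTree
end LemmaC
section SubTrees

namespace MGTree
variable {G : Type u} [Group G]

theorem sub_tm (T : MGTree G) (W : Set T.V)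
    (hmed : ∀ x ∈ W, ∀ y ∈ W, ∀ z ∈ W, ∀ m, Btwn T.dist x m y → Btwn T.dist y m z →
      Btwn T.dist x m z → m ∈ W) : TreeMet (fun x y : W => T.dist x.1 y.1) := by
  have h := T.tm
  refine ⟨fun x => h.self _, fun x y hxy => h.pos _ _ (fun hc => hxy (Subtype.ext hc)),
    fun x y => h.symm _ _, fun x y z w => h.four _ _ _ _, ?_, ?_⟩
  · intro x y z
    obtain ⟨m, h1, h2, h3⟩ := h.med x.1 y.1 z.1
    exact ⟨⟨m, hmed _ x.2 _ y.2 _ z.2 m h1 h2 h3⟩, h1, h2, h3⟩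
  · intro x y
    exact (h.fin x.1 y.1).preimage Subtype.val_injective.injOn

/-- The subtree spanned by a median-closed invariant set. -/
noncomputable def subTree (T : MGTree G) (W : Set T.V) (hne : W.Nonempty)
    (hinv : ∀ g, ∀ w ∈ W, T.act g w ∈ W)
    (hmed : ∀ x ∈ W, ∀ y ∈ W, ∀ z ∈ W, ∀ m, Btwn T.dist x m y → Btwn T.dist y m z →
      Btwn T.dist x m z → m ∈ W)
    (hno : ∀ g, ∀ w ∈ W, ∀ w' ∈ W, T.act g w = w' → T.act g w' = w → w ≠ w' →
      ∃ z ∈ W, z ≠ w ∧ z ≠ w' ∧ Btwn T.dist w z w') : MGTree G where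
  V := W
  nonempty := hne.to_subtype
  graph := metGraph (T.sub_tm W hmed)
  isTree := by
    have := hne.to_subtype
    exact (T.sub_tm W hmed).metGraph_isTree
  act :=
    { toFun := fun g =>
        { toFun := fun w => ⟨T.act g w.1, hinv g w.1 w.2⟩
          invFun := fun w => ⟨T.act g⁻¹ w.1, hinv g⁻¹ w.1 w.2⟩
          left_inv := fun w => Subtype.ext (T.act_inv_act g w.1)
          right_inv := fun w => Subtype.ext (T.act_act_inv g w.1) }
      map_one' := by
        ext w; exact T.act_one' w.1
      map_mul' := by
        intro a b
        ext w; exact T.act_mul' a b w.1 }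
  adj_act := by
    rintro g u v ⟨h1, h2⟩
    refine ⟨fun hc => h1 (Equiv.injective _ hc), fun z hz => ?_⟩
    have hz' : Btwn T.dist (T.act g u.1) z.1 (T.act g v.1) := hz
    have h3 := T.btwn_act g⁻¹ hz'
    rw [T.act_inv_act, T.act_inv_act] at h3
    rcases h2 ⟨T.act g⁻¹ z.1, hinv _ _ z.2⟩ h3 with h4 | h4
    · left
      apply Subtype.ext
      have := congrArg (fun w : W => T.act g w.1) h4
      simp only at this
      rw [T.act_act_inv] at this
      exact this
    · right
      apply Subtype.ext
      have := congrArg (fun w : W => T.act g w.1) h4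
      simp only at this
      rw [T.act_act_inv] at this
      exact this
  noInversion := by
    rintro g u v ⟨h1, h2⟩ ⟨h3, h4⟩
    obtain ⟨z, hz, hzu, hzv, hb⟩ := hno g u.1 u.2 v.1 v.2 (congrArg Subtype.val h3)
      (congrArg Subtype.val h4) (fun hc => h1 (Subtype.ext hc))
    rcases h2 ⟨z, hz⟩ hb with h5 | h5
    · exact hzu (congrArg Subtype.val h5)
    · exact hzv (congrArg Subtype.val h5)
  minimal := by
    intro S hS hSinv hSconv
    have h := T.sub_tm W hmed
    have := hne.to_subtype
    rw [Set.eq_univ_iff_forall]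
    intro z
    obtain ⟨_, ⟨s, hs, rfl⟩, _, ⟨s', hs', rfl⟩, hb⟩ := T.hull (Subtype.val '' S)
      (hS.image _) (by
        rintro g _ ⟨w, hw, rfl⟩
        exact ⟨_, hSinv g w hw, rfl⟩) z.1
    obtain ⟨p, hp⟩ := h.metGraph_isTree.1.exists_isPath s s'
    exact hSconv s hs s' hs' p hp z (h.mem_walk (fun x y hxy => hxy) hb p)
  len := fun x y => T.dist x.1 y.1
  len_symm := fun x y => T.tm.symm _ _
  len_pos := fun x y hxy => T.tm.pos _ _ (fun hc => hxy.1 (Subtype.ext hc))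
  len_equivariant := fun g x y => T.dist_act g _ _

theorem subTree_dist (T : MGTree G) (W : Set T.V) (hne : W.Nonempty)
    (hinv : ∀ g, ∀ w ∈ W, T.act g w ∈ W)
    (hmed : ∀ x ∈ W, ∀ y ∈ W, ∀ z ∈ W, ∀ m, Btwn T.dist x m y → Btwn T.dist y m z →
      Btwn T.dist x m z → m ∈ W)
    (hno : ∀ g, ∀ w ∈ W, ∀ w' ∈ W, T.act g w = w' → T.act g w' = w → w ≠ w' →
      ∃ z ∈ W, z ≠ w ∧ z ≠ w' ∧ Btwn T.dist w z w') (x y : W) :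
    (T.subTree W hne hinv hmed hno).dist x y = T.dist x.1 y.1 := by
  exact MGTree.dist_eq_of (T.subTree W hne hinv hmed hno) (fun x y : W => T.dist x.1 y.1)
    (T.sub_tm W hmed) (fun x y => Iff.rfl) (fun x y _ => rfl) x y

/-- Medians of images of vertices. -/
def medSet (T T' : MGTree G) (f : T.V → T'.V) : Set T'.V :=
  {w | ∃ a b c, Btwn T'.dist (f a) w (f b) ∧ Btwn T'.dist (f b) w (f c) ∧
    Btwn T'.dist (f a) w (f c)}

theorem medSet_range (T T' : MGTree G) (f : T.V → T'.V) (v : T.V) : f v ∈ medSet T T' f :=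
  ⟨v, v, v, T'.tm.b_left _ _, T'.tm.b_left _ _, T'.tm.b_left _ _⟩

theorem medSet_ne (T T' : MGTree G) (f : T.V → T'.V) : (medSet T T' f).Nonempty := by
  obtain ⟨v⟩ := T.nonempty
  exact ⟨_, medSet_range T T' f v⟩

theorem medSet_inv (T T' : MGTree G) (f : T.V → T'.V)
    (hf : ∀ g v, f (T.act g v) = T'.act g (f v)) (g : G) (w : T'.V)
    (hw : w ∈ medSet T T' f) : T'.act g w ∈ medSet T T' f := by
  obtain ⟨a, b, c, h1, h2, h3⟩ := hw
  refine ⟨T.act g a, T.act g b, T.act g c, ?_, ?_, ?_⟩ <;> rw [hf, hf]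
  · exact T'.btwn_act g h1
  · exact T'.btwn_act g h2
  · exact T'.btwn_act g h3

theorem medSet_med (T T' : MGTree G) (f : T.V → T'.V) (x : T'.V) (hx : x ∈ medSet T T' f)
    (y : T'.V) (hy : y ∈ medSet T T' f) (z : T'.V) (hz : z ∈ medSet T T' f) (m : T'.V)
    (h1 : Btwn T'.dist x m y) (h2 : Btwn T'.dist y m z) (h3 : Btwn T'.dist x m z) :
    m ∈ medSet T T' f := by
  have h := T'.tm
  by_cases hmx : m = x
  · rwa [hmx]
  by_cases hmy : m = y
  · rwa [hmy]
  by_cases hmz : m = z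
  · rwa [hmz]
  have key : ∀ w ∈ medSet T T' f, ∃ a, Btwn T'.dist m w (f a) := by
    rintro w ⟨a, b, c, e1, e2, e3⟩
    rcases h.split e1 m with e | e
    · exact ⟨a, h.b_symm e⟩
    · exact ⟨b, e⟩
  obtain ⟨a, ha⟩ := key x hx
  obtain ⟨b, hb⟩ := key y hy
  obtain ⟨c, hc⟩ := key z hz
  refine ⟨a, b, c, ?_, ?_, ?_⟩
  · exact h.b_symm (h.concat (h.b_symm (h.concat h1 ha hmx)) hb hmy)
  · exact h.b_symm (h.concat (h.b_symm (h.concat h2 hb hmy)) hc hmz)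
  · exact h.b_symm (h.concat (h.b_symm (h.concat h3 ha hmx)) hc hmz)

theorem swap_fixed (T : MGTree G) (g : G) {w w' : T.V} (h1 : T.act g w = w')
    (h2 : T.act g w' = w) : ∃ q, T.act g q = q := by
  have h := T.tm
  have hsq : ∀ x, Btwn T.dist w x w' → T.act g (T.act g x) = x := by
    intro x hx
    rw [← T.act_mul']
    exact T.fixed_btwn (g * g) (by rw [T.act_mul', h1, h2]) (by rw [T.act_mul', h2, h1]) hx
  obtain ⟨x, hx, hmin⟩ := Set.exists_min_image {x | Btwn T.dist w x w'}
    (fun x => T.dist x (T.act g x)) (h.fin w w') ⟨w, h.b_left w w'⟩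
  refine ⟨x, ?_⟩
  by_contra hne
  have hgx : Btwn T.dist w (T.act g x) w' := by
    have := T.btwn_act g hx
    rw [h1, h2] at this
    exact h.b_symm this
  obtain ⟨b, hb, hbx⟩ := T.exists_next (Ne.symm hne)
  have hbw : Btwn T.dist w b w' := by
    -- the segment is convex
    by_contra hc
    have e1 := h.split hbx w
    have e2 := h.split hbx w'
    have hbxne : b ≠ x := hb.ne.symm
    by_cases hbg : b = T.act g x
    · rw [hbg] at hc; exact hc hgx
    have sx := h.split hx b
    have sg := h.split hgx b
    apply hc
    have u1 : ∃ s, (s = w ∨ s = w') ∧ Btwn T.dist b x s := by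
      rcases sx with e | e
      · exact ⟨w, Or.inl rfl, h.b_symm e⟩
      · exact ⟨w', Or.inr rfl, e⟩
    have u2 : ∃ s, (s = w ∨ s = w') ∧ Btwn T.dist b (T.act g x) s := by
      rcases sg with e | e
      · exact ⟨w, Or.inl rfl, h.b_symm e⟩
      · exact ⟨w', Or.inr rfl, e⟩
    obtain ⟨s, hs, u1⟩ := u1
    obtain ⟨s', hs', u2⟩ := u2
    have u3 := h.concat (h.b_symm (h.concat hbx u1 hbxne)) u2 hbg
    rcases hs with rfl | rfl <;> rcases hs' with rfl | rfl
    · rw [h.b_same u3]; exact h.b_left _ _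
    · exact h.b_symm u3
    · exact u3
    · rw [h.b_same u3]; exact h.b_right _ _
  have hgg := hsq x hx
  by_cases hbg : b = T.act g x
  · exact T.noInversion g x b hb ⟨hbg.symm, by rw [hbg]; exact hgg⟩
  have e3 := hmin b hbw
  have e4 := T.btwn_act g hbx
  rw [hgg] at e4
  have e5 := T.dist_act g x b
  have p1 := h.pos x b hb.ne
  have p2 := h.pos b _ hbg
  have s := h.symm
  have e6 := h.b_symm e4
  rcases le_total (T.dist x b) (T.dist x (T.act g b)) with hle | hle
  · have e7 := h.b_of_le hbx e6 hle
    unfold Btwn at *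
    linarith [s (T.act g x) (T.act g b), s (T.act g x) x]
  · have e7 := h.b_of_le e6 hbx hle
    unfold Btwn at *
    linarith [s (T.act g x) (T.act g b), s (T.act g x) x, s b (T.act g b)]

theorem medSet_no (T T' : MGTree G) (f : T.V → T'.V)
    (hf : ∀ g v, f (T.act g v) = T'.act g (f v))
    (hell : ∀ H : Subgroup G, T'.Elliptic H → T.Elliptic H) (g : G) (w : T'.V)
    (hw : w ∈ medSet T T' f) (w' : T'.V) (hw' : w' ∈ medSet T T' f) (h1 : T'.act g w = w')
    (h2 : T'.act g w' = w) (hne : w ≠ w') :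
    ∃ z ∈ medSet T T' f, z ≠ w ∧ z ≠ w' ∧ Btwn T'.dist w z w' := by
  have h := T'.tm
  obtain ⟨q, hq⟩ := T'.swap_fixed g h1 h2
  obtain ⟨v, hv⟩ := hell (Subgroup.zpowers g) ⟨q, by
    have : Subgroup.zpowers g ≤ T'.stab q := by
      rw [Subgroup.zpowers_le]; exact hq
    exact fun k hk => this hk⟩
  have hv := hv g (Subgroup.mem_zpowers g)
  have hfv : T'.act g (f v) = f v := by rw [← hf, hv]
  obtain ⟨m, m1, m2, m3⟩ := h.med w w' (f v)
  have hmg : T'.act g m = m := by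
    have e1 := T'.btwn_act g m1
    have e2 := T'.btwn_act g m2
    have e3 := T'.btwn_act g m3
    rw [h1, h2] at e1
    rw [h2, hfv] at e2
    rw [h1, hfv] at e3
    exact h.med_uniq (h.b_symm e1) e3 e2 m1 m2 m3
  refine ⟨m, medSet_med T T' f w hw w' hw' _ (medSet_range T T' f v) m m1 m2 m3, ?_, ?_, m1⟩
  · rintro rfl
    exact hne (hmg.symm.trans h1)
  · rintro rfl
    exact hne (h2.symm.trans hmg)

/-- The tree spanned by medians. -/
noncomputable def medTree (T T' : MGTree G) (f : T.V → T'.V)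
    (hf : ∀ g v, f (T.act g v) = T'.act g (f v))
    (hell : ∀ H : Subgroup G, T'.Elliptic H → T.Elliptic H) : MGTree G :=
  T'.subTree (medSet T T' f) (medSet_ne T T' f) (medSet_inv T T' f hf) (medSet_med T T' f)
    (medSet_no T T' f hf hell)

theorem minEdge [Group.FG G] (T : MGTree G)
    (hlf : ∀ v : T.V, {w : T.V | T.graph.Adj v w}.Finite) :
    ∃ l : ℝ, 0 < l ∧ ∀ u v, T.graph.Adj u v → l ≤ T.dist u v := by
  obtain ⟨R, hR⟩ := T.cofinite
  have hfin : (⋃ r ∈ R, (fun w => T.dist r w) '' {w : T.V | T.graph.Adj r w}).Finite :=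
    Set.Finite.biUnion R.finite_toSet (fun r _ => (hlf r).image _)
  obtain ⟨l, hl, hmin⟩ := Set.exists_min_image (insert 1 (⋃ r ∈ R, (fun w => T.dist r w) ''
    {w : T.V | T.graph.Adj r w})) id (hfin.insert 1) ⟨1, Set.mem_insert _ _⟩
  refine ⟨l, ?_, ?_⟩
  · rcases hl with rfl | hl
    · exact one_pos
    · simp only [Set.mem_iUnion] at hl
      obtain ⟨r, _, w, hw, rfl⟩ := hl
      exact T.tm.pos r w (SimpleGraph.Adj.ne hw)
  · intro u v huv
    obtain ⟨g, r, hr, rfl⟩ := hR u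
    have e : v = T.act g (T.act g⁻¹ v) := (T.act_act_inv g v).symm
    rw [e, T.dist_act]
    rw [e, T.adj_act_iff] at huv
    refine hmin _ (Or.inr ?_)
    simp only [Set.mem_iUnion]
    exact ⟨r, hr, _, huv, rfl⟩

section MedTree
variable {T T' : MGTree G} {f : T.V → T'.V}
    (hf : ∀ g v, f (T.act g v) = T'.act g (f v))
    (hell : ∀ H : Subgroup G, T'.Elliptic H → T.Elliptic H)

/-- Inclusion of the median tree. -/
def mincl (w : (medTree T T' f hf hell).V) : T'.V := Subtype.val (p := fun w => w ∈ medSet T T' f) w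

/-- Points of the median tree. -/
def mmk (w : T'.V) (hw : w ∈ medSet T T' f) : (medTree T T' f hf hell).V :=
  (⟨w, hw⟩ : medSet T T' f)

theorem mincl_mmk (w : T'.V) (hw : w ∈ medSet T T' f) :
    mincl hf hell (mmk hf hell w hw) = w := rfl

theorem mincl_mem (w : (medTree T T' f hf hell).V) : mincl hf hell w ∈ medSet T T' f :=
  Subtype.property (p := fun w => w ∈ medSet T T' f) w

theorem mincl_inj {w w' : (medTree T T' f hf hell).V}
    (h : mincl hf hell w = mincl hf hell w') : w = w' :=
  Subtype.ext (p := fun w => w ∈ medSet T T' f) h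

theorem mincl_act (g : G) (w : (medTree T T' f hf hell).V) :
    mincl hf hell ((medTree T T' f hf hell).act g w) = T'.act g (mincl hf hell w) := rfl

theorem medTree_dist (x y : (medTree T T' f hf hell).V) :
    (medTree T T' f hf hell).dist x y = T'.dist (mincl hf hell x) (mincl hf hell y) :=
  T'.subTree_dist _ _ _ _ _ x y

theorem medTree_sameDef : SameDef T.toGTree (medTree T T' f hf hell).toGTree := by
  intro H
  constructor
  · rintro ⟨v, hv⟩
    refine ⟨mmk hf hell (f v) (medSet_range T T' f v), fun k hk => ?_⟩
    apply mincl_inj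
    rw [mincl_act, mincl_mmk, ← hf, hv k hk]
  · rintro ⟨w, hw⟩
    apply hell
    exact ⟨mincl hf hell w, fun k hk => by rw [← mincl_act, hw k hk]⟩

theorem medTree_collapse [Group.FG G]
    (hlf : ∀ v : (medTree T T' f hf hell).V, {w | (medTree T T' f hf hell).graph.Adj v w}.Finite) :
    CollapseOf (medTree T T' f hf hell).toGTree T'.toGTree := by
  obtain ⟨l, hl, hl'⟩ := minEdge _ hlf
  refine Near.collapse (T := medTree T T' f hf hell) (T' := T')
    (f := mincl hf hell) (l := l) (δ := 0) ⟨?_, le_rfl, hl, by linarith, hl', ?_⟩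
  · intro g v; exact mincl_act hf hell g v
  · intro v a b _ _
    rw [medTree_dist]
    simp

/-- `T'` is in every neighbourhood of the median tree. -/
theorem mem_gromovBasic_medTree (X : Finset (medTree T T' f hf hell).V) (A : Finset G) (ε : ℝ)
    (hε : 0 < ε) : T' ∈ gromovBasic G (medTree T T' f hf hell) X A ε := by
  refine ⟨mincl hf hell, ?_⟩
  intro x _ y _ g _
  rw [medTree_dist, mincl_act]
  simpa using hε

theorem Near.medTree {l δ : ℝ} (N : Near T T' f l δ) :
    Near T (medTree T T' f hf hell) (fun v => mmk hf hell (f v) (medSet_range T T' f v)) l δ := by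
  refine ⟨?_, N.nonneg, N.lpos, N.small, N.edge, ?_⟩
  · intro g v
    apply mincl_inj
    rw [mincl_act, mincl_mmk, mincl_mmk, hf]
  · intro v a b ha hb
    rw [medTree_dist, mincl_mmk, mincl_mmk]
    exact N.star v a b ha hb

end MedTree

end MGTree
end SubTrees
section FiniteType

namespace MGTree
variable {G : Type u} [Group G]

/-- The median of three vertices. -/
noncomputable def mu (T : MGTree G) (a b c : T.V) : T.V := (T.tm.med a b c).choose

theorem mu_spec (T : MGTree G) (a b c : T.V) : Btwn T.dist a (T.mu a b c) b ∧
    Btwn T.dist b (T.mu a b c) c ∧ Btwn T.dist a (T.mu a b c) c := (T.tm.med a b c).choose_spec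

theorem mu_eq (T : MGTree G) {a b c m : T.V} (h1 : Btwn T.dist a m b) (h2 : Btwn T.dist b m c)
    (h3 : Btwn T.dist a m c) : T.mu a b c = m := by
  obtain ⟨e1, e2, e3⟩ := T.mu_spec a b c
  exact T.tm.med_uniq e1 e2 e3 h1 h2 h3

theorem mu_act (T : MGTree G) (g : G) (a b c : T.V) :
    T.mu (T.act g a) (T.act g b) (T.act g c) = T.act g (T.mu a b c) := by
  obtain ⟨e1, e2, e3⟩ := T.mu_spec a b c
  exact T.mu_eq (T.btwn_act g e1) (T.btwn_act g e2) (T.btwn_act g e3)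

theorem mu_mem (T T' : MGTree G) (f : T.V → T'.V) (a b c : T.V) :
    T'.mu (f a) (f b) (f c) ∈ medSet T T' f := ⟨a, b, c, T'.mu_spec _ _ _⟩

theorem med_close (T : MGTree G) {a b c m p : T.V} {κ : ℝ} (h1 : Btwn T.dist a m b)
    (h2 : Btwn T.dist b m c) (h3 : Btwn T.dist a m c)
    (k1 : T.dist a p + T.dist p b - T.dist a b ≤ 2 * κ)
    (k2 : T.dist b p + T.dist p c - T.dist b c ≤ 2 * κ)
    (k3 : T.dist a p + T.dist p c - T.dist a c ≤ 2 * κ) : T.dist m p ≤ κ := by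
  have h := T.tm
  have s := h.symm
  have key : ∀ x y, Btwn T.dist x m y → Btwn T.dist p m x → Btwn T.dist p m y →
      T.dist x p + T.dist p y - T.dist x y ≤ 2 * κ → T.dist m p ≤ κ := by
    intro x y e1 e2 e3 e4
    unfold Btwn at *
    linarith [s x p, s m p, s x m]
  rcases h.split h1 p with e1 | e1
  · rcases h.split h2 p with e2 | e2
    · exact key a b h1 (h.b_symm e1) (h.b_symm e2) k1
    · exact key a c h3 (h.b_symm e1) e2 k3
  · rcases h.split h3 p with e2 | e2
    · exact key a b h1 (h.b_symm e2) e1 k1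
    · exact key b c h2 e1 e2 k2

/-- The closed star. -/
def Nb (T : MGTree G) (v a : T.V) : Prop := a = v ∨ T.graph.Adj v a

/-- Local triples. -/
structure Loc (T : MGTree G) (v x y z : T.V) : Prop where
  nx : T.Nb v x
  ny : T.Nb v y
  nz : T.Nb v z
  xy : x = y → x = v
  yz : y = z → y = v
  xz : x = z → x = v

theorem Nb.act {T : MGTree G} {v a : T.V} (h : T.Nb v a) (g : G) :
    T.Nb (T.act g v) (T.act g a) := by
  rcases h with rfl | h
  · exact Or.inl rfl
  · exact Or.inr (T.adj_act g _ _ h)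

theorem Loc.act {T : MGTree G} {v x y z : T.V} (h : T.Loc v x y z) (g : G) :
    T.Loc (T.act g v) (T.act g x) (T.act g y) (T.act g z) := by
  have inj := (T.act g).injective
  refine ⟨h.nx.act g, h.ny.act g, h.nz.act g, ?_, ?_, ?_⟩
  · intro hc; rw [h.xy (inj hc)]
  · intro hc; rw [h.yz (inj hc)]
  · intro hc; rw [h.xz (inj hc)]

theorem nb_btwn (T : MGTree G) {v x y : T.V} (hx : T.Nb v x) (hy : T.Nb v y) (hxy : x = y → x = v) :
    Btwn T.dist x v y := by
  have h := T.tm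
  rcases hx with rfl | hx
  · exact h.b_left _ _
  rcases hy with rfl | hy
  · exact h.b_right _ _
  rcases h.adj_side (T.adj_iff.1 hx) y with e | e
  · exact h.b_symm e
  · rcases (T.adj_iff.1 hy).2 x (h.b_symm e) with e1 | e1
    · exact absurd e1 hx.ne.symm
    · exact absurd (hxy e1) hx.ne.symm

namespace Near
variable {T T' : MGTree G} {f : T.V → T'.V} {l δ : ℝ}

theorem gp' (N : Near T T' f l δ) {a v b : T.V} (hb : Btwn T.dist a v b) :
    T'.dist (f a) (f v) + T'.dist (f v) (f b) - T'.dist (f a) (f b) ≤ 3 * δ := by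
  have h := T.tm
  have h' := T'.tm
  have s := h'.symm
  have nn := N.nonneg
  by_cases hav : v = a
  · rw [hav, h'.self]; linarith
  obtain ⟨x, hx, hxa⟩ := T.exists_next hav
  have e1 : Btwn T.dist x v b := (h.b_trans hb (h.b_symm hxa)).2
  have k1 := N.gp b v x hx.symm e1
  have k2 := N.gp a x v hx hxa
  have h4 := N.edge' hx
  have h5 := N.small
  have h6 := N.lpos
  rcases h'.four (f x) (f b) (f v) (f a) with h7 | h7
  · linarith [s (f x) (f v), s (f a) (f b), s (f a) (f v)]
  · linarith [s (f x) (f v), s (f b) (f v), s (f a) (f v)]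

theorem far (N : Near T T' f l δ) {v v' : T.V} (hne : v ≠ v') :
    l - 4 * δ ≤ T'.dist (f v) (f v') := by
  obtain ⟨x, hx, hxa⟩ := T.exists_next hne
  have k := N.gp v' x v hx hxa
  have h4 := N.edge' hx
  linarith [T'.tm.nonneg (f x) (f v')]

theorem loc_close (N : Near T T' f l δ) {v x y z : T.V} (L : T.Loc v x y z) :
    T'.dist (T'.mu (f x) (f y) (f z)) (f v) ≤ 3 / 2 * δ := by
  obtain ⟨e1, e2, e3⟩ := T'.mu_spec (f x) (f y) (f z)
  refine T'.med_close e1 e2 e3 ?_ ?_ ?_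
  · linarith [N.gp' (T.nb_btwn L.nx L.ny L.xy)]
  · linarith [N.gp' (T.nb_btwn L.ny L.nz L.yz)]
  · linarith [N.gp' (T.nb_btwn L.nx L.nz L.xz)]

theorem loc_center (N : Near T T' f l δ) {v x y z v' x' y' z' : T.V} (L : T.Loc v x y z)
    (L' : T.Loc v' x' y' z')
    (he : T'.mu (f x) (f y) (f z) = T'.mu (f x') (f y') (f z')) : v = v' := by
  by_contra hne
  have h1 := N.loc_close L
  have h2 := N.loc_close L'
  rw [he] at h1
  have h3 := N.far hne
  have h := T'.tm
  linarith [h.tri (f v) (T'.mu (f x') (f y') (f z')) (f v'),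
    h.symm (f v) (T'.mu (f x') (f y') (f z')), N.small, N.lpos, N.nonneg]

theorem repl (N : Near T T' f l δ) {v a x : T.V} {w q : T'.V}
    (hx : (a = v ∧ x = v) ∨ (T.graph.Adj v x ∧ Btwn T.dist v x a))
    (hw : T'.dist w (f v) ≤ 3 / 2 * δ) (hb : Btwn T'.dist (f a) w q) :
    Btwn T'.dist (f x) w q := by
  have h := T'.tm
  have s := h.symm
  rcases hx with ⟨rfl, rfl⟩ | ⟨hx, hxa⟩
  · exact hb
  obtain ⟨n, n1, n2, n3⟩ := h.med (f v) (f x) (f a)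
  have k := N.gp a x v hx hxa
  have h4 := N.edge' hx
  have h5 := N.small
  have h6 := N.lpos
  have nn := N.nonneg
  have dn : l - 3 * δ ≤ T'.dist (f v) n := by
    unfold Btwn at n1 n2 n3
    linarith [s (f x) n]
  have key : ∀ p, Btwn T'.dist (f v) n p → Btwn T'.dist w n p := by
    intro p hp
    rcases h.split hp w with e | e
    · exfalso
      unfold Btwn at e
      linarith [s w (f v), h.nonneg n w]
    · exact e
  have ka := key _ n3
  have kx := key _ n1
  have hne : w ≠ n := by
    rintro rfl
    linarith [s w (f v)]
  have e1 := (h.b_trans hb (h.b_symm ka)).2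
  exact h.concat e1 kx hne

theorem loc_exists (N : Near T T' f l δ) {w : T'.V} (hw : w ∈ medSet T T' f) :
    ∃ v x y z, T.Loc v x y z ∧ T'.mu (f x) (f y) (f z) = w := by
  have h := T.tm
  have h' := T'.tm
  obtain ⟨a, b, c, h1, h2, h3⟩ := hw
  obtain ⟨v, v1, v2, v3⟩ := h.med a b c
  have dw : T'.dist w (f v) ≤ 3 / 2 * δ := by
    refine T'.med_close h1 h2 h3 ?_ ?_ ?_
    · linarith [N.gp' v1]
    · linarith [N.gp' v2]
    · linarith [N.gp' v3]
  have nxt : ∀ a : T.V, ∃ x, (a = v ∧ x = v) ∨ (T.graph.Adj v x ∧ Btwn T.dist v x a) := by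
    intro a
    by_cases ha : a = v
    · exact ⟨v, Or.inl ⟨ha, rfl⟩⟩
    · obtain ⟨x, hx⟩ := T.exists_next (Ne.symm ha)
      exact ⟨x, Or.inr hx⟩
  have nbh : ∀ {a x : T.V}, ((a = v ∧ x = v) ∨ (T.graph.Adj v x ∧ Btwn T.dist v x a)) →
      T.Nb v x ∧ Btwn T.dist v x a := by
    rintro a x (⟨rfl, rfl⟩ | ⟨e1, e2⟩)
    · exact ⟨Or.inl rfl, h.b_left _ _⟩
    · exact ⟨Or.inr e1, e2⟩
  have sep : ∀ {a b x : T.V}, Btwn T.dist a v b → Btwn T.dist v x a → Btwn T.dist v x b → x = v := by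
    intro a b x e1 e2 e3
    apply h.eq_of_le
    unfold Btwn at *
    linarith [h.symm a v, h.symm v x, h.tri a x b, h.symm a x]
  obtain ⟨x, hx⟩ := nxt a
  obtain ⟨y, hy⟩ := nxt b
  obtain ⟨z, hz⟩ := nxt c
  have hx' := nbh hx
  have hy' := nbh hy
  have hz' := nbh hz
  refine ⟨v, x, y, z, ⟨hx'.1, hy'.1, hz'.1, ?_, ?_, ?_⟩, ?_⟩
  · rintro rfl; exact sep v1 hx'.2 hy'.2
  · rintro rfl; exact sep v2 hy'.2 hz'.2
  · rintro rfl; exact sep v3 hx'.2 hz'.2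
  · refine T'.mu_eq ?_ ?_ ?_
    · exact h'.b_symm (N.repl hy dw (h'.b_symm (N.repl hx dw h1)))
    · exact h'.b_symm (N.repl hz dw (h'.b_symm (N.repl hy dw h2)))
    · exact h'.b_symm (N.repl hz dw (h'.b_symm (N.repl hx dw h3)))

end Near

/-- Adjacency in the median tree. -/
def AdjW (T T' : MGTree G) (f : T.V → T'.V) (w w' : T'.V) : Prop :=
  w ≠ w' ∧ ∀ z ∈ medSet T T' f, Btwn T'.dist w z w' → z = w ∨ z = w'

theorem AdjW.act {T T' : MGTree G} {f : T.V → T'.V}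
    (hf : ∀ g v, f (T.act g v) = T'.act g (f v)) {w w' : T'.V} (h : AdjW T T' f w w') (g : G) :
    AdjW T T' f (T'.act g w) (T'.act g w') := by
  refine ⟨fun hc => h.1 ((T'.act g).injective hc), fun z hz hb => ?_⟩
  have h1 := T'.btwn_act g⁻¹ hb
  rw [T'.act_inv_act, T'.act_inv_act] at h1
  rcases h.2 _ (medSet_inv T T' f hf g⁻¹ z hz) h1 with e | e
  · left; rw [← e, T'.act_act_inv]
  · right; rw [← e, T'.act_act_inv]

theorem medTree_adj {T T' : MGTree G} {f : T.V → T'.V}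
    (hf : ∀ g v, f (T.act g v) = T'.act g (f v))
    (hell : ∀ H : Subgroup G, T'.Elliptic H → T.Elliptic H) (x y : (medTree T T' f hf hell).V) :
    (medTree T T' f hf hell).graph.Adj x y ↔ AdjW T T' f (mincl hf hell x) (mincl hf hell y) := by
  rw [adj_iff]
  constructor
  · rintro ⟨h1, h2⟩
    refine ⟨fun hc => h1 (mincl_inj hf hell hc), fun z hz hb => ?_⟩
    have := h2 (mmk hf hell z hz) (by
      unfold Btwn at *
      rw [medTree_dist, medTree_dist, medTree_dist, mincl_mmk]; exact hb)
    rcases this with e | e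
    · left; rw [← e, mincl_mmk]
    · right; rw [← e, mincl_mmk]
  · rintro ⟨h1, h2⟩
    refine ⟨fun hc => h1 (by rw [hc]), fun z hb => ?_⟩
    have := h2 (mincl hf hell z) (mincl_mem hf hell z) (by
      unfold Btwn at *
      rw [medTree_dist, medTree_dist, medTree_dist] at hb; exact hb)
    rcases this with e | e
    · left; exact mincl_inj hf hell e
    · right; exact mincl_inj hf hell e

theorem Near.loc_adj {T T' : MGTree G} {f : T.V → T'.V} {l δ : ℝ} (N : Near T T' f l δ)
    {v x y z v' x' y' z' : T.V} (L : T.Loc v x y z) (L' : T.Loc v' x' y' z')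
    (ha : AdjW T T' f (T'.mu (f x) (f y) (f z)) (T'.mu (f x') (f y') (f z'))) : T.Nb v v' := by
  have h := T.tm
  have h' := T'.tm
  have s := h'.symm
  have h1 := N.loc_close L
  have h2 := N.loc_close L'
  generalize T'.mu (f x) (f y) (f z) = w at *
  generalize T'.mu (f x') (f y') (f z') = w' at *
  by_contra hnb
  unfold Nb at hnb
  push Not at hnb
  obtain ⟨b, hb, hbx⟩ := T.exists_next (Ne.symm hnb.1)
  have hbv : b ≠ v' := by
    rintro rfl; exact hnb.2 hb
  have hmem := mu_mem T T' f b v v'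
  obtain ⟨e1, e2, e3⟩ := T'.mu_spec (f b) (f v) (f v')
  have nn := N.nonneg
  have dn : T'.dist (T'.mu (f b) (f v) (f v')) (f b) ≤ 3 / 2 * δ := by
    refine T'.med_close e1 e2 e3 ?_ ?_ ?_
    · linarith [h'.self (f b)]
    · linarith [N.gp' hbx]
    · linarith [h'.self (f b)]
  generalize T'.mu (f b) (f v) (f v') = n at *
  have h4 := N.edge' hb
  have h5 := N.small
  have h6 := N.lpos
  have h7 := N.far hbv
  have t1 := h'.tri (f v) n (f b)
  have t2 := h'.tri (f b) n (f v')
  have g1 : Btwn T'.dist w n (f v') := by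
    rcases h'.split e2 w with e | e
    · exfalso
      unfold Btwn at e
      linarith [s w (f v), h'.nonneg n w]
    · exact e
  have g2 : Btwn T'.dist w n w' := by
    rcases h'.split g1 w' with e | e
    · exact e
    · exfalso
      unfold Btwn at e
      linarith [s n (f b), h'.nonneg w' n]
  rcases ha.2 n hmem g2 with rfl | rfl
  · linarith [s n (f v)]
  · linarith [s n (f b)]

/-- Equality of types gives a collapse. -/
theorem collapse_of_type {T T₁ T₂ : MGTree G} {f₁ : T.V → T₁.V} {f₂ : T.V → T₂.V} {l δ : ℝ}
    (N₁ : Near T T₁ f₁ l δ) (N₂ : Near T T₂ f₂ l δ)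
    (he₁ : ∀ H : Subgroup G, T₁.Elliptic H → T.Elliptic H)
    (he₂ : ∀ H : Subgroup G, T₂.Elliptic H → T.Elliptic H) (B : Set T.V)
    (hB : ∀ v, ∃ g, ∀ v' a, T.Nb (T.act g v) v' → T.Nb v' a → a ∈ B)
    (hsame : ∀ x ∈ B, ∀ y ∈ B, ∀ z ∈ B, ∀ x' ∈ B, ∀ y' ∈ B, ∀ z' ∈ B,
      ((T₁.mu (f₁ x) (f₁ y) (f₁ z) = T₁.mu (f₁ x') (f₁ y') (f₁ z')) ↔
        (T₂.mu (f₂ x) (f₂ y) (f₂ z) = T₂.mu (f₂ x') (f₂ y') (f₂ z'))) ∧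
      ((AdjW T T₁ f₁ (T₁.mu (f₁ x) (f₁ y) (f₁ z)) (T₁.mu (f₁ x') (f₁ y') (f₁ z'))) ↔
        (AdjW T T₂ f₂ (T₂.mu (f₂ x) (f₂ y) (f₂ z)) (T₂.mu (f₂ x') (f₂ y') (f₂ z'))))) :
    CollapseOf (medTree T T₂ f₂ N₂.equi he₂).toGTree (medTree T T₁ f₁ N₁.equi he₁).toGTree := by
  have m1 : ∀ g x y z, T₁.mu (f₁ (T.act g x)) (f₁ (T.act g y)) (f₁ (T.act g z)) =
      T₁.act g (T₁.mu (f₁ x) (f₁ y) (f₁ z)) := by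
    intro g x y z; rw [N₁.equi, N₁.equi, N₁.equi, mu_act]
  have m2 : ∀ g x y z, T₂.mu (f₂ (T.act g x)) (f₂ (T.act g y)) (f₂ (T.act g z)) =
      T₂.act g (T₂.mu (f₂ x) (f₂ y) (f₂ z)) := by
    intro g x y z; rw [N₂.equi, N₂.equi, N₂.equi, mu_act]
  have a1 : ∀ g w w', AdjW T T₁ f₁ (T₁.act g w) (T₁.act g w') ↔ AdjW T T₁ f₁ w w' := by
    intro g w w'
    refine ⟨fun h => ?_, fun h => h.act N₁.equi g⟩
    have := h.act N₁.equi g⁻¹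
    rwa [T₁.act_inv_act, T₁.act_inv_act] at this
  have a2 : ∀ g w w', AdjW T T₂ f₂ (T₂.act g w) (T₂.act g w') ↔ AdjW T T₂ f₂ w w' := by
    intro g w w'
    refine ⟨fun h => ?_, fun h => h.act N₂.equi g⟩
    have := h.act N₂.equi g⁻¹
    rwa [T₂.act_inv_act, T₂.act_inv_act] at this
  have glob : ∀ {v x y z v' x' y' z' : T.V}, T.Loc v x y z → T.Loc v' x' y' z' → T.Nb v v' →
      ((T₁.mu (f₁ x) (f₁ y) (f₁ z) = T₁.mu (f₁ x') (f₁ y') (f₁ z')) ↔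
        (T₂.mu (f₂ x) (f₂ y) (f₂ z) = T₂.mu (f₂ x') (f₂ y') (f₂ z'))) ∧
      ((AdjW T T₁ f₁ (T₁.mu (f₁ x) (f₁ y) (f₁ z)) (T₁.mu (f₁ x') (f₁ y') (f₁ z'))) ↔
        (AdjW T T₂ f₂ (T₂.mu (f₂ x) (f₂ y) (f₂ z)) (T₂.mu (f₂ x') (f₂ y') (f₂ z')))) := by
    intro v x y z v' x' y' z' L L' hnb
    obtain ⟨g, hg⟩ := hB v
    have Lg := L.act g
    have Lg' := L'.act g
    have hnb' := hnb.act g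
    have hself : T.Nb (T.act g v) (T.act g v) := Or.inl rfl
    have := hsame _ (hg _ _ hself Lg.nx) _ (hg _ _ hself Lg.ny) _ (hg _ _ hself Lg.nz)
      _ (hg _ _ hnb' Lg'.nx) _ (hg _ _ hnb' Lg'.ny) _ (hg _ _ hnb' Lg'.nz)
    simp only [m1, m2, a1, a2, (T₁.act g).injective.eq_iff, (T₂.act g).injective.eq_iff] at this
    exact this
  have heq : ∀ {v x y z v' x' y' z' : T.V}, T.Loc v x y z → T.Loc v' x' y' z' →
      ((T₁.mu (f₁ x) (f₁ y) (f₁ z) = T₁.mu (f₁ x') (f₁ y') (f₁ z')) ↔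
        (T₂.mu (f₂ x) (f₂ y) (f₂ z) = T₂.mu (f₂ x') (f₂ y') (f₂ z'))) := by
    intro v x y z v' x' y' z' L L'
    constructor
    · intro h
      have := N₁.loc_center L L' h
      subst this
      exact (glob L L' (Or.inl rfl)).1.1 h
    · intro h
      have := N₂.loc_center L L' h
      subst this
      exact (glob L L' (Or.inl rfl)).1.2 h
  have hadj : ∀ {v x y z v' x' y' z' : T.V}, T.Loc v x y z → T.Loc v' x' y' z' →
      ((AdjW T T₁ f₁ (T₁.mu (f₁ x) (f₁ y) (f₁ z)) (T₁.mu (f₁ x') (f₁ y') (f₁ z'))) ↔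
        (AdjW T T₂ f₂ (T₂.mu (f₂ x) (f₂ y) (f₂ z)) (T₂.mu (f₂ x') (f₂ y') (f₂ z')))) := by
    intro v x y z v' x' y' z' L L'
    constructor
    · intro h
      exact (glob L L' (N₁.loc_adj L L' h)).2.1 h
    · intro h
      exact (glob L L' (N₂.loc_adj L L' h)).2.2 h
  choose v x y z L hmu using
    fun w : (medTree T T₁ f₁ N₁.equi he₁).V => N₁.loc_exists (mincl_mem N₁.equi he₁ w)
  let c : (medTree T T₁ f₁ N₁.equi he₁).V → (medTree T T₂ f₂ N₂.equi he₂).V := fun w =>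
    mmk N₂.equi he₂ (T₂.mu (f₂ (x w)) (f₂ (y w)) (f₂ (z w))) (mu_mem T T₂ f₂ _ _ _)
  have hc : ∀ w, mincl N₂.equi he₂ (c w) = T₂.mu (f₂ (x w)) (f₂ (y w)) (f₂ (z w)) :=
    fun w => mincl_mmk _ _ _ _
  have hc' : ∀ w v' x' y' z', T.Loc v' x' y' z' →
      T₁.mu (f₁ x') (f₁ y') (f₁ z') = mincl N₁.equi he₁ w →
      mincl N₂.equi he₂ (c w) = T₂.mu (f₂ x') (f₂ y') (f₂ z') := by
    intro w v' x' y' z' L' h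
    rw [hc]
    exact (heq (L w) L').1 ((hmu w).trans h.symm)
  have hinj : ∀ w w', c w = c w' → w = w' := by
    intro w w' h
    have h1 := congrArg (mincl N₂.equi he₂) h
    rw [hc, hc] at h1
    apply mincl_inj N₁.equi he₁
    rw [← hmu, ← hmu]
    exact (heq (L w) (L w')).2 h1
  have hsurj : ∀ u, ∃ w, c w = u := by
    intro u
    obtain ⟨v', x', y', z', L', h⟩ := N₂.loc_exists (mincl_mem N₂.equi he₂ u)
    refine ⟨mmk N₁.equi he₁ (T₁.mu (f₁ x') (f₁ y') (f₁ z')) (mu_mem T T₁ f₁ _ _ _), ?_⟩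
    apply mincl_inj
    rw [hc' _ v' x' y' z' L' (mincl_mmk _ _ _ _).symm, h]
  have hcadj : ∀ w w', (medTree T T₁ f₁ N₁.equi he₁).graph.Adj w w' ↔
      (medTree T T₂ f₂ N₂.equi he₂).graph.Adj (c w) (c w') := by
    intro w w'
    rw [medTree_adj, medTree_adj, hc, hc, ← hmu w, ← hmu w']
    exact hadj (L w) (L w')
  refine ⟨c, ?_, hsurj, fun w w' h _ => (hcadj w w').1 h, ?_, ?_⟩
  · intro g w
    apply mincl_inj N₂.equi he₂
    rw [mincl_act, hc w, ← m2]
    apply hc' _ _ _ _ _ ((L w).act g)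
    rw [m1, mincl_act, hmu]
  · intro u' v' h
    obtain ⟨w, rfl⟩ := hsurj u'
    obtain ⟨w', rfl⟩ := hsurj v'
    exact ⟨w, w', (hcadj w w').2 h, rfl, rfl⟩
  · intro a b hab p hp w hw
    have := hinj a b hab
    subst this
    rw [(MGTree.mem_iff_btwn _ hp)] at hw
    rw [(tm _).b_same hw]

end MGTree
end FiniteType
namespace MGTree

theorem collapse_refl {G : Type u} [Group G] [Group.FG G] (T : MGTree G)
    (hlf : ∀ v : T.V, {w : T.V | T.graph.Adj v w}.Finite) :
    CollapseOf T.toGTree T.toGTree := by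
  obtain ⟨l, hl, hl'⟩ := minEdge T hlf
  refine Near.collapse (T := T) (T' := T) (f := id) (l := l) (δ := 0)
    ⟨fun _ _ => rfl, le_rfl, hl, by linarith, hl', fun v a b _ _ => by simp⟩

/-- The local combinatorial type of an approximation `f` of `T` by `T'`, read off `B`. -/
def ltype {G : Type u} [Group G] (T T' : MGTree G) (f : T.V → T'.V) (B : Finset T.V)
    (p q : ↥B × ↥B × ↥B) : Prop × Prop :=
  (T'.mu (f p.1) (f p.2.1) (f p.2.2) = T'.mu (f q.1) (f q.2.1) (f q.2.2),
    AdjW T T' f (T'.mu (f p.1) (f p.2.1) (f p.2.2)) (T'.mu (f q.1) (f q.2.1) (f q.2.2)))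

theorem self_mem_basic {G : Type u} [Group G] (T : MGTree G) (X : Finset T.V) (A : Finset G)
    (ε : ℝ) (hε : 0 < ε) : T ∈ gromovBasic G T X A ε :=
  ⟨id, fun x _ y _ g _ => by simpa using hε⟩

theorem basic_open {G : Type u} [Group G] (T : MGTree G) (X : Finset T.V) (A : Finset G)
    (ε : ℝ) : @IsOpen _ (gromovTop G) (gromovBasic G T X A ε) := by
  rintro T' ⟨f, hf⟩
  obtain ⟨η, hη, hη'⟩ : ∃ η : ℝ, 0 < η ∧ ∀ x ∈ X, ∀ y ∈ X, ∀ g ∈ A,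
      |T.dist x (T.act g y) - T'.dist (f x) (T'.act g (f y))| + η ≤ ε := by
    by_cases hne : (X ×ˢ X ×ˢ A).Nonempty
    · obtain ⟨p, hp, hmin⟩ := Finset.exists_min_image (X ×ˢ X ×ˢ A) (fun p =>
        ε - |T.dist p.1 (T.act p.2.2 p.2.1) - T'.dist (f p.1) (T'.act p.2.2 (f p.2.1))|) hne
      simp only [Finset.mem_product] at hp
      refine ⟨_, sub_pos.2 (hf p.1 hp.1 p.2.1 hp.2.1 p.2.2 hp.2.2), ?_⟩
      intro x hx y hy g hg
      have := hmin (x, y, g) (by simp [hx, hy, hg])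
      simp only at this
      linarith
    · refine ⟨1, one_pos, ?_⟩
      intro x hx y hy g hg
      exact absurd ⟨(x, y, g), by simp [hx, hy, hg]⟩ hne
  refine ⟨X.image f, A, η, hη, ?_⟩
  rintro T'' ⟨f', hf'⟩
  refine ⟨fun v => f' (f v), fun x hx y hy g hg => ?_⟩
  have h1 := hη' x hx y hy g hg
  have h2 := hf' (f x) (Finset.mem_image_of_mem f hx) (f y) (Finset.mem_image_of_mem f hy) g hg
  have h3 := abs_sub_le (T.dist x (T.act g y)) (T'.dist (f x) (T'.act g (f y)))
    (T''.dist (f' (f x)) (T''.act g (f' (f y))))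
  linarith

theorem core {G : Type u} [Group G] [Group.FG G] (T₀ : MGTree G)
    (D : Set (MGTree G)) (hD : D = {T : MGTree G | SameDef T₀.toGTree T.toGTree})
    (hlf : ∀ T ∈ D, ∀ v : T.V, {w : T.V | T.graph.Adj v w}.Finite)
    (hfg : ∀ T ∈ D, ∀ v : T.V, (T.stab v).FG) (U : Set (MGTree G))
    (hU : ∀ S ∈ D, ∀ T ∈ U, T ∈ closedCone D S → ∃ (X : Finset T.V) (A : Finset G) (ε : ℝ),
      0 < ε ∧ ∀ T', T' ∈ gromovBasic G T X A ε → T' ∈ closedCone D S → T' ∈ U)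
    (T : MGTree G) (hTD : T ∈ D) (hTU : T ∈ U) :
    ∃ (X : Finset T.V) (A : Finset G) (ε : ℝ), 0 < ε ∧ ∀ T', T' ∈ gromovBasic G T X A ε →
      T' ∈ D → T' ∈ U := by
  have hsd : ∀ S, S ∈ D ↔ SameDef T.toGTree S.toGTree := by
    subst hD
    intro S
    exact ⟨fun h H => (hTD H).symm.trans (h H), fun h H => (hTD H).trans (h H)⟩
  have hell : ∀ S ∈ D, ∀ H : Subgroup G, S.Elliptic H → T.Elliptic H :=
    fun S hS H h => ((hsd S).1 hS H).2 h
  obtain ⟨R, hR⟩ := T.cofinite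
  obtain ⟨l, hl, hl'⟩ := minEdge T (hlf T hTD)
  have hnbfin : ∀ v, {a | T.Nb v a}.Finite := fun v =>
    ((hlf T hTD v).insert v).subset (by rintro a (h | h); exacts [Or.inl h, Or.inr h])
  have hBfin : (⋃ r ∈ R, ⋃ v ∈ {v | T.Nb r v}, {a | T.Nb v a}).Finite :=
    Set.Finite.biUnion R.finite_toSet fun r _ => (hnbfin r).biUnion fun v _ => hnbfin v
  obtain ⟨B, hBdef⟩ : ∃ B : Finset T.V, ∀ r ∈ R, ∀ v a, T.Nb r v → T.Nb v a → a ∈ B := by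
    refine ⟨hBfin.toFinset, fun r hr v a h1 h2 => ?_⟩
    rw [Set.Finite.mem_toFinset]
    simp only [Set.mem_iUnion]
    exact ⟨r, hr, v, h1, h2⟩
  have hB : ∀ v, ∃ g, ∀ v' a, T.Nb (T.act g v) v' → T.Nb v' a → a ∈ (B : Set T.V) := by
    intro v
    obtain ⟨g, r, hr, rfl⟩ := hR v
    refine ⟨g⁻¹, fun v' a h1 h2 => ?_⟩
    rw [T.act_inv_act] at h1
    exact hBdef r hr v' a h1 h2
  -- one neighbourhood for each local type
  have step : ∀ τ : ↥B × ↥B × ↥B → ↥B × ↥B × ↥B → Prop × Prop,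
      ∃ (X : Finset T.V) (A : Finset G) (ε : ℝ), 0 < ε ∧
      ∀ (T₂ : MGTree G) (h₂ : T₂ ∈ D) (f₂ : T.V → T₂.V) (N₂ : Near T T₂ f₂ l (l / 20)),
        ltype T T₂ f₂ B = τ →
        medTree T T₂ f₂ N₂.equi (hell T₂ h₂) ∈ gromovBasic G T X A ε →
        medTree T T₂ f₂ N₂.equi (hell T₂ h₂) ∈ U := by
    intro τ
    by_cases hex : ∃ (T₁ : MGTree G) (f₁ : T.V → T₁.V), T₁ ∈ D ∧ Near T T₁ f₁ l (l / 20) ∧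
        ltype T T₁ f₁ B = τ
    · obtain ⟨T₁, f₁, h₁, N₁, hτ⟩ := hex
      have hS : medTree T T₁ f₁ N₁.equi (hell T₁ h₁) ∈ D :=
        (hsd _).2 (medTree_sameDef N₁.equi (hell T₁ h₁))
      obtain ⟨X, A, ε, hε, hX⟩ := hU _ hS T hTU
        ⟨hTD, (Near.medTree N₁.equi (hell T₁ h₁) N₁).collapse⟩
      refine ⟨X, A, ε, hε, fun T₂ h₂ f₂ N₂ hτ₂ hmem => hX _ hmem ⟨?_, ?_⟩⟩
      · exact (hsd _).2 (medTree_sameDef N₂.equi (hell T₂ h₂))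
      · refine collapse_of_type N₁ N₂ (hell T₁ h₁) (hell T₂ h₂) (B : Set T.V) hB ?_
        intro x hx y hy z hz x' hx' y' hy' z' hz'
        have e := congrFun (congrFun (hτ.trans hτ₂.symm) (⟨x, hx⟩, ⟨y, hy⟩, ⟨z, hz⟩))
          (⟨x', hx'⟩, ⟨y', hy'⟩, ⟨z', hz'⟩)
        exact ⟨iff_of_eq (congrArg Prod.fst e), iff_of_eq (congrArg Prod.snd e)⟩
    · refine ⟨∅, ∅, 1, one_pos, fun T₂ h₂ f₂ N₂ hτ₂ _ => ?_⟩
      exact absurd ⟨T₂, f₂, h₂, N₂, hτ₂⟩ hex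
  choose X A ε hε hstep using step
  have : Nonempty (↥B × ↥B × ↥B → ↥B × ↥B × ↥B → Prop × Prop) := ⟨fun _ _ => (True, True)⟩
  have : Fintype (↥B × ↥B × ↥B → ↥B × ↥B × ↥B → Prop × Prop) := Fintype.ofFinite _
  obtain ⟨τ₀, hτ₀⟩ := Finite.exists_min ε
  let XX : Finset T.V := Finset.univ.biUnion X
  let AA : Finset G := Finset.univ.biUnion A
  have hXX : ∀ τ, ∀ x ∈ X τ, x ∈ XX := fun τ x hx => Finset.mem_biUnion.2 ⟨τ, Finset.mem_univ _, hx⟩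
  have hAA : ∀ τ, ∀ x ∈ A τ, x ∈ AA := fun τ x hx => Finset.mem_biUnion.2 ⟨τ, Finset.mem_univ _, hx⟩
  obtain ⟨X', A', ε', hε', hA⟩ := lemmaA T (hfg T hTD)
    (B ∪ XX ∪ (AA ×ˢ XX).image (fun p => T.act p.1 p.2)) (min (l / 20) (ε τ₀))
    (lt_min (by linarith) (hε _))
  refine ⟨X', A', ε', hε', fun T' hT' hT'D => ?_⟩
  obtain ⟨f, hf, hest⟩ := hA T' (fun H h => ((hsd T').1 hT'D H).1 h) hT'
  have N : Near T T' f l (l / 20) := by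
    refine ⟨hf, by linarith, hl, by linarith, hl', ?_⟩
    intro v a b ha hb
    obtain ⟨g, r, hr, rfl⟩ := hR v
    have ha' : T.Nb r (T.act g⁻¹ a) := by
      have := Nb.act (show T.Nb _ a from ha) g⁻¹
      rwa [T.act_inv_act] at this
    have hb' : T.Nb r (T.act g⁻¹ b) := by
      have := Nb.act (show T.Nb _ b from hb) g⁻¹
      rwa [T.act_inv_act] at this
    have h1 := hest _ (Finset.mem_union_left _ (Finset.mem_union_left _
      (hBdef r hr r _ (Or.inl rfl) ha'))) _ (Finset.mem_union_left _ (Finset.mem_union_left _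
      (hBdef r hr r _ (Or.inl rfl) hb')))
    rw [hf, hf, T.dist_act, T'.dist_act] at h1
    exact (h1.le).trans (min_le_left _ _)
  have hmD : medTree T T' f N.equi (hell T' hT'D) ∈ D :=
    (hsd _).2 (medTree_sameDef N.equi (hell T' hT'D))
  have hmU : medTree T T' f N.equi (hell T' hT'D) ∈ U := by
    refine hstep (ltype T T' f B) T' hT'D f N rfl ?_
    refine ⟨fun v => mmk N.equi (hell T' hT'D) (f v) (medSet_range T T' f v), ?_⟩
    intro x hx y hy g hg
    rw [medTree_dist, mincl_act, mincl_mmk, mincl_mmk, ← hf]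
    refine (hest x ?_ _ ?_).trans_le ((min_le_right _ _).trans (hτ₀ _))
    · exact Finset.mem_union_left _ (Finset.mem_union_right _ (hXX _ x hx))
    · exact Finset.mem_union_right _ (Finset.mem_image.2 ⟨(g, y),
        Finset.mem_product.2 ⟨hAA _ g hg, hXX _ y hy⟩, rfl⟩)
  obtain ⟨X₃, A₃, ε₃, hε₃, h₃⟩ := hU T' hT'D _ hmU
    ⟨hmD, medTree_collapse N.equi (hell T' hT'D) (hlf _ hmD)⟩
  exact h₃ T' (mem_gromovBasic_medTree N.equi (hell T' hT'D) X₃ A₃ ε₃ hε₃)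
    ⟨hT'D, collapse_refl T' (hlf T' hT'D)⟩

theorem weak_eq {G : Type u} [Group G] [Group.FG G] (T₀ : MGTree G)
    (D : Set (MGTree G)) (hD : D = {T : MGTree G | SameDef T₀.toGTree T.toGTree})
    (hlf : ∀ T ∈ D, ∀ v : T.V, {w : T.V | T.graph.Adj v w}.Finite)
    (hfg : ∀ T ∈ D, ∀ v : T.V, (T.stab v).FG) :
    weakTop G D = TopologicalSpace.induced (fun x : ↥D => (x : MGTree G)) (gromovTop G) := by
  apply le_antisymm
  · refine iSup₂_le fun T _ => ?_
    rw [coinduced_le_iff_le_induced, induced_compose]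
    exact le_rfl
  · intro W hW
    have hW' : ∀ S ∈ D, @IsOpen _ (TopologicalSpace.induced
        (fun x : {S' : MGTree G // S' ∈ closedCone D S} => x.1) (gromovTop G))
        ((fun x : {S' : MGTree G // S' ∈ closedCone D S} => (⟨x.1, x.2.1⟩ : ↥D)) ⁻¹' W) := by
      intro S hS
      exact (le_iSup₂ (f := fun (T : MGTree G) (_ : T ∈ D) => TopologicalSpace.coinduced
        (fun x : {S : MGTree G // S ∈ closedCone D T} => (⟨x.1, x.2.1⟩ : ↥D))
        (TopologicalSpace.induced (fun x : {S : MGTree G // S ∈ closedCone D T} => x.1)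
        (gromovTop G))) S hS) W hW
    have hcore := core T₀ D hD hlf hfg {T | ∃ h : T ∈ D, (⟨T, h⟩ : ↥D) ∈ W} (by
      rintro S hS T ⟨hTD, hTW⟩ hTc
      obtain ⟨O, hO, hOW⟩ := (@isOpen_induced_iff _ _ (gromovTop G) _ _).1 (hW' S hS)
      have hTO : T ∈ O := by
        have : (⟨T, hTc⟩ : {S' : MGTree G // S' ∈ closedCone D S}) ∈
          ((fun x : {S' : MGTree G // S' ∈ closedCone D S} => x.1) ⁻¹' O) := by
          rw [hOW]; exact hTW
        exact this
      obtain ⟨X, A, ε, hε, hsub⟩ := hO T hTO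
      refine ⟨X, A, ε, hε, fun T' hT' hT'c => ⟨hT'c.1, ?_⟩⟩
      have : (⟨T', hT'c⟩ : {S' : MGTree G // S' ∈ closedCone D S}) ∈
          ((fun x : {S' : MGTree G // S' ∈ closedCone D S} => x.1) ⁻¹' O) := hsub hT'
      rw [hOW] at this
      exact this)
    have hcore' : ∀ w : ↥D, w ∈ W → ∃ (X : Finset w.1.V) (A : Finset G) (ε : ℝ), 0 < ε ∧
        ∀ T', T' ∈ gromovBasic G w.1 X A ε → ∀ h : T' ∈ D, (⟨T', h⟩ : ↥D) ∈ W := by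
      intro w hw
      obtain ⟨X, A, ε, hε, h⟩ := hcore w.1 w.2 ⟨w.2, hw⟩
      exact ⟨X, A, ε, hε, fun T' h1 h2 => (h T' h1 h2).2⟩
    choose! X A ε hε hin using hcore'
    refine (@isOpen_induced_iff _ _ (gromovTop G) _ _).2 ⟨⋃ w ∈ W, gromovBasic G w.1 (X w) (A w) (ε w), ?_, ?_⟩
    · letI := gromovTop G
      exact isOpen_biUnion fun w _ => basic_open w.1 (X w) (A w) (ε w)
    · ext w
      simp only [Set.mem_preimage, Set.mem_iUnion]
      constructor
      · rintro ⟨w', hw', hmem⟩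
        exact hin w' hw' _ hmem w.2
      · intro hw
        exact ⟨w, hw, self_mem_basic _ _ _ _ (hε w hw)⟩

end MGTree

/-- **Proposition (Guirardel–Levitt, Proposition 5.6).** If the deformation space `D`
(irreducible or genuine abelian) consists of locally finite trees with finitely
generated vertex stabilizers, then the equivariant Gromov–Hausdorff topology and the
weak topology coincide on `D` and on the projectivized space `PD`. -/
theorem statement_8 {G : Type u} [Group G] [Group.FG G] (T₀ : MGTree G)
    (D : Set (MGTree G)) (hD : D = {T : MGTree G | SameDef T₀.toGTree T.toGTree})
    (htype : T₀.Irr ∨ T₀.toGTree.GenuineAbelian)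
    (hlf : ∀ T ∈ D, ∀ v : T.V, {w : T.V | T.graph.Adj v w}.Finite)
    (hfg : ∀ T ∈ D, ∀ v : T.V, (T.stab v).FG) :
    weakTop G D = TopologicalSpace.induced (fun x : ↥D => (x : MGTree G)) (gromovTop G) ∧
    (weakTop G D).coinduced (Quot.mk (projRel D)) =
      (TopologicalSpace.induced (fun x : ↥D => (x : MGTree G)) (gromovTop G)).coinduced
        (Quot.mk (projRel D)) := by
  have h := MGTree.weak_eq T₀ D hD hlf hfg
  exact ⟨h, by rw [h]⟩
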